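/- Suppose all existentially closed models of T₀ have the same existential theory. If an e-atomic expansion of N exists, then the set of e-atomic expansions is comeagre in Exp(N, T₀). -/

import Mathlib

open FirstOrder FirstOrder.Language

namespace GenExp

/-- The type of expansions of the `L`-structure `N` to the language `L.sum L'`:
an expansion is an interpretation of the new symbols, i.e. an `L'`-structure on `N`. -/
def Expansions (L L' : FirstOrder.Language.{0,0}) (N : Type) [L.Structure N] : Type :=
  L'.Structure N

variable {L L' : FirstOrder.Language.{0,0}} {N : Type} [L.Structure N]

/-- The underlying `L'`-structure of an expansion. -/
def Expansions.str (σ : Expansions L L' N) : L'.Structure N := σ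

/-- The `(L.sum L')`-structure on `N` determined by an expansion. -/
def Expansions.str0 (σ : Expansions L L' N) : (L.sum L').Structure N :=
  letI := σ.str
  inferInstance

/-- `(N, σ)` realizes the `L₀`-formula `φ` at the tuple `c` of parameters. -/
def Expansions.Realizes (σ : Expansions L L' N) {n : ℕ}
    (φ : (L.sum L').Formula (Fin n)) (c : Fin n → N) : Prop :=
  letI := σ.str0
  φ.Realize c

/-- `(N, σ)` is a model of the `L₀`-theory `T₀`. -/
def Expansions.ModelsTh (σ : Expansions L L' N) (T₀ : (L.sum L').Theory) : Prop :=
  letI := σ.str0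
  N ⊨ T₀

/-- The topology on `Exp(N)` generated by the sets `[φ]_N` for quantifier-free
`L₀`-sentences `φ` with parameters in `N` (coded as formulas plus an assignment). -/
instance (L L' : FirstOrder.Language.{0,0}) (N : Type) [L.Structure N] :
    TopologicalSpace (Expansions L L' N) :=
  TopologicalSpace.generateFrom
    {s | ∃ (n : ℕ) (φ : (L.sum L').Formula (Fin n)) (c : Fin n → N),
      φ.IsQF ∧ s = {σ : Expansions L L' N | σ.Realizes φ c}}

/-- `Exp(N, T₀)`, as a subset of `Exp(N)`. -/
def ExpSet (L L' : FirstOrder.Language.{0,0}) (N : Type) [L.Structure N] (T₀ : (L.sum L').Theory) :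
    Set (Expansions L L' N) :=
  {σ | σ.ModelsTh T₀}

/-- An `L₀`-sentence is universal modulo `T` if it is equivalent to a universal sentence
in every model of `T`. -/
def UniversalModulo (L L' : FirstOrder.Language.{0,0}) (T : L.Theory) (φ : (L.sum L').Sentence) : Prop :=
  ∃ ψ : (L.sum L').Sentence, BoundedFormula.IsUniversal ψ ∧
    ∀ (U : Type) [L.Structure U] [L'.Structure U], U ⊨ T → (U ⊨ φ ↔ U ⊨ ψ)

/-- A theory is universal modulo `T` if all its sentences are. -/
def UniversalTheoryModulo (L L' : FirstOrder.Language.{0,0}) (T : L.Theory)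
    (T₀ : (L.sum L').Theory) : Prop :=
  ∀ φ ∈ T₀, UniversalModulo L L' T φ

/-- `T` has quantifier elimination. -/
def HasQE (L : FirstOrder.Language.{0,0}) (T : L.Theory) : Prop :=
  ∀ (n : ℕ) (φ : L.Formula (Fin n)), ∃ ψ : L.Formula (Fin n), ψ.IsQF ∧ T ⊨ᵇ φ.iff ψ

/-- `T` is small: countably many complete `n`-types for every `n`. -/
def IsSmall (L : FirstOrder.Language.{0,0}) (T : L.Theory) : Prop :=
  ∀ n : ℕ, Countable (T.CompleteType (Fin n))

/-- `N` is (ω-)saturated: every finitely realized set of `L`-formulas in one variable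
with finitely many parameters in `N` is realized in `N`. -/
def IsSaturated (L : FirstOrder.Language.{0,0}) (N : Type) [L.Structure N] : Prop :=
  ∀ (k : ℕ) (c : Fin k → N) (p : Set (L.Formula (Fin k ⊕ Fin 1))),
    (∀ s : Finset (L.Formula (Fin k ⊕ Fin 1)), ↑s ⊆ p →
      ∃ x : N, ∀ φ ∈ s, φ.Realize (Sum.elim c fun _ => x)) →
    ∃ x : N, ∀ φ ∈ p, φ.Realize (Sum.elim c fun _ => x)

/-- `σ` is an existentially closed expansion: every quantifier-free `L₀`-formula with
parameters in `N` that has a solution in some model of `T₀` extending `(N, σ)` has a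
solution in `(N, σ)`. -/
def Expansions.IsEC (σ : Expansions L L' N) (T₀ : (L.sum L').Theory) : Prop :=
  letI := σ.str0
  ∀ (k n : ℕ) (φ : (L.sum L').Formula (Fin k ⊕ Fin n)) (c : Fin k → N), φ.IsQF →
    (∃ (U : Type) (iU : L.Structure U) (iU' : L'.Structure U),
      letI := iU; letI := iU';
      ∃ _j : N ↪[L.sum L'] U, (U ⊨ T₀) ∧ ∃ x : Fin n → U, φ.Realize (Sum.elim (_j ∘ c) x)) →
    ∃ x : Fin n → N, φ.Realize (Sum.elim c x)

/-- `σ` is a smooth expansion: it realizes every finitely consistent type of the form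
`p↾L(x) ∪ {ψ(x)}` with `ψ` quantifier-free in `L₀` and `p↾L` an `L`-type with finitely
many parameters. -/
def Expansions.IsSmooth (σ : Expansions L L' N) : Prop :=
  letI := σ.str0
  ∀ (k n : ℕ) (c : Fin k → N) (p : Set (L.Formula (Fin k ⊕ Fin n)))
    (ψ : (L.sum L').Formula (Fin k ⊕ Fin n)), ψ.IsQF →
    (∀ s : Finset (L.Formula (Fin k ⊕ Fin n)), ↑s ⊆ p →
      ∃ x : Fin n → N, ψ.Realize (Sum.elim c x) ∧
        ∀ χ ∈ s, Formula.Realize (L := L) (M := N) χ (Sum.elim c x)) →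
    ∃ x : Fin n → N, ψ.Realize (Sum.elim c x) ∧
      ∀ χ ∈ p, Formula.Realize (L := L) (M := N) χ (Sum.elim c x)

/-- The set `Y` of smooth existentially closed expansions in `Exp(N, T₀)`. -/
def YSet (L L' : FirstOrder.Language.{0,0}) (N : Type) [L.Structure N] (T₀ : (L.sum L').Theory) :
    Set (Expansions L L' N) :=
  {σ | σ.ModelsTh T₀ ∧ σ.IsSmooth ∧ σ.IsEC T₀}


/-- A general existentially closed model of `T₀` (in the class of models of `T₀`). -/
def IsECModel (L L' : FirstOrder.Language.{0,0}) (T₀ : (L.sum L').Theory)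
    (U : Type) [L.Structure U] [L'.Structure U] : Prop :=
  (U ⊨ T₀) ∧
  ∀ (k n : ℕ) (φ : (L.sum L').Formula (Fin k ⊕ Fin n)) (c : Fin k → U), φ.IsQF →
    (∃ (V : Type) (iV : L.Structure V) (iV' : L'.Structure V),
      letI := iV; letI := iV';
      ∃ _j : U ↪[L.sum L'] V, (V ⊨ T₀) ∧ ∃ x : Fin n → V, φ.Realize (Sum.elim (_j ∘ c) x)) →
    ∃ x : Fin n → U, φ.Realize (Sum.elim c x)

/-- All existentially closed models of `T₀` have the same existential theory. -/
def SameExistentialTheory (L L' : FirstOrder.Language.{0,0}) (T₀ : (L.sum L').Theory) : Prop :=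
  ∀ (U : Type) [L.Structure U] [L'.Structure U] (V : Type) [L.Structure V] [L'.Structure V],
    IsECModel L L' T₀ U → IsECModel L L' T₀ V →
    ∀ φ : (L.sum L').Sentence, BoundedFormula.IsExistential φ → ((U ⊨ φ) ↔ (V ⊨ φ))

/-- An existential quasifinite formula `∃ y (p(x,y) ∧ φ(x,y))`, where `p` is a
parameter-free `L`-type and `φ` is a quantifier-free `L₀`-formula. -/
structure EQF (L L' : FirstOrder.Language.{0,0}) (n : ℕ) : Type where
  m : ℕ
  p : Set (L.Formula (Fin n ⊕ Fin m))
  φ : (L.sum L').Formula (Fin n ⊕ Fin m)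
  qf : φ.IsQF

/-- Realization of an existential quasifinite formula at a tuple `b` in `(N, σ)`. -/
def EQF.RealizeAt {n : ℕ} (π : EQF L L' n) (σ : Expansions L L' N) (b : Fin n → N) : Prop :=
  letI := σ.str0
  ∃ y : Fin π.m → N,
    (∀ χ ∈ π.p, Formula.Realize (L := L) (M := N) χ (Sum.elim b y)) ∧
      π.φ.Realize (Sum.elim b y)

/-- The complete parameter-free `L₀`-type of the tuple `a` in `(N, σ)`. -/
def fullType (σ : Expansions L L' N) {n : ℕ} (a : Fin n → N) :
    Set ((L.sum L').Formula (Fin n)) :=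
  {φ | σ.Realizes φ a}

/-- `p↾1`: the universal and existential formulas in `p`. -/
def restr1 {L L' : FirstOrder.Language.{0,0}} {n : ℕ}
    (p : Set ((L.sum L').Formula (Fin n))) : Set ((L.sum L').Formula (Fin n)) :=
  {φ ∈ p | BoundedFormula.IsUniversal φ ∨ BoundedFormula.IsExistential φ}

/-- The 1-diagram of `σ` at `b`: all universal and existential formulas satisfied by `b`
in `(N, σ)` (coding sentences with parameters `b` as formulas). -/
def diag1 (σ : Expansions L L' N) {n : ℕ} (b : Fin n → N) :
    Set ((L.sum L').Formula (Fin n)) :=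
  restr1 (fullType σ b)

variable (L L' N) in
/-- The set `D_b` of 1-diagrams at `b` of expansions in `Y`. -/
def DSet (T₀ : (L.sum L').Theory) {n : ℕ} (b : Fin n → N) :
    Set (Set ((L.sum L').Formula (Fin n))) :=
  {d | ∃ σ ∈ YSet L L' N T₀, d = diag1 σ b}

variable (L L' N) in
/-- The basic subset `[π(b)]_D` of `D_b`. -/
def DBasic (T₀ : (L.sum L').Theory) {n : ℕ} (b : Fin n → N) (π : EQF L L' n) :
    Set (Set ((L.sum L').Formula (Fin n))) :=
  {d | ∃ σ ∈ YSet L L' N T₀, d = diag1 σ b ∧ π.RealizeAt σ b}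

variable (L L' N) in
/-- The topology on `D_b` generated by the sets `[π(b)]_D`. -/
def DTop (T₀ : (L.sum L').Theory) {n : ℕ} (b : Fin n → N) :
    TopologicalSpace ↥(DSet L L' N T₀ b) :=
  TopologicalSpace.generateFrom
    {s | ∃ π : EQF L L' n, s = {d | ↑d ∈ DBasic L L' N T₀ b π}}

variable (L L' N) in
/-- The set `S_x^Y` of types `p↾1` for `p` a complete parameter-free type realized in `Y`. -/
def SSet (T₀ : (L.sum L').Theory) (n : ℕ) : Set (Set ((L.sum L').Formula (Fin n))) :=
  {q | ∃ σ ∈ YSet L L' N T₀, ∃ a : Fin n → N, q = diag1 σ a}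

variable (L L' N) in
/-- The basic subset `[π(x)]_S` of `S_x^Y`. -/
def SBasic (T₀ : (L.sum L').Theory) {n : ℕ} (π : EQF L L' n) :
    Set (Set ((L.sum L').Formula (Fin n))) :=
  {q | ∃ σ ∈ YSet L L' N T₀, ∃ a : Fin n → N, q = diag1 σ a ∧ π.RealizeAt σ a}

variable (L L' N) in
/-- The topology on `S_x^Y` generated by the sets `[π(x)]_S`. -/
def STop (T₀ : (L.sum L').Theory) (n : ℕ) : TopologicalSpace ↥(SSet L L' N T₀ n) :=
  TopologicalSpace.generateFrom
    {s | ∃ π : EQF L L' n, s = {q | ↑q ∈ SBasic L L' N T₀ π}}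

variable (L L' N) in
/-- `α` is an e-atomic expansion: it is in `Y` and each of its 1-diagrams is an
isolated point of `D_b`. -/
def IsEAtomic (T₀ : (L.sum L').Theory) (α : Expansions L L' N) : Prop :=
  α ∈ YSet L L' N T₀ ∧ ∀ (n : ℕ) (b : Fin n → N),
    @IsOpen _ (DTop L L' N T₀ b) {d | (d : Set ((L.sum L').Formula (Fin n))) = diag1 α b}

/-- The conjugate expansion `σ^g` of `σ` under an automorphism `g` of `N`. -/
def conjExp (g : N ≃[L] N) (σ : Expansions L L' N) : Expansions L L' N :=
  show L'.Structure N from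
  { funMap := fun {_} F a => g ((σ.str).funMap F fun i => g.symm (a i))
    RelMap := fun {_} R a => (σ.str).RelMap R fun i => g.symm (a i) }

variable (L L' N) in
/-- `τ` is Truss generic: its conjugacy class is comeagre in `Exp(N, T₀)`. -/
def IsTrussGeneric (T₀ : (L.sum L').Theory) (τ : Expansions L L' N) : Prop :=
  τ.ModelsTh T₀ ∧
    {σ : ↥(ExpSet L L' N T₀) | ∃ g : N ≃[L] N, (σ : Expansions L L' N) = conjExp g τ} ∈
      residual ↥(ExpSet L L' N T₀)


variable (L L' N) in
/-- The quantifier-free formula `φ` (with parameters `c`) has a solution in `(N, σ)`. -/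
def SolvableIn (σ : Expansions L L' N) {k n : ℕ}
    (φ : (L.sum L').Formula (Fin k ⊕ Fin n)) (c : Fin k → N) : Prop :=
  letI := σ.str0
  ∃ x : Fin n → N, φ.Realize (Sum.elim c x)

variable (L L' N) in
/-- The formula `φ` (with parameters `c`) has a solution in some model of `T₀`
extending `(N, σ)`. -/
def SolvableInExtension (T₀ : (L.sum L').Theory) (σ : Expansions L L' N) {k n : ℕ}
    (φ : (L.sum L').Formula (Fin k ⊕ Fin n)) (c : Fin k → N) : Prop :=
  letI := σ.str0
  ∃ (U : Type) (iU : L.Structure U) (iU' : L'.Structure U),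
    letI := iU; letI := iU';
    ∃ _j : N ↪[L.sum L'] U, (U ⊨ T₀) ∧ ∃ x : Fin n → U, φ.Realize (Sum.elim (_j ∘ c) x)

section Basics

/-- Every `(L.sum L')`-structure comes from an `L`-structure and an `L'`-structure. -/
theorem exists_sumStructure_eq (W : Type) (S : (L.sum L').Structure W) :
    ∃ (iL : L.Structure W) (iL' : L'.Structure W), @sumStructure L L' W iL iL' = S := by
  refine ⟨(LHom.sumInl : L →ᴸ L.sum L').reduct W, (LHom.sumInr : L' →ᴸ L.sum L').reduct W, ?_⟩
  ext n f
  · cases f <;> rfl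
  · cases f <;> rfl

/-- A bundled nonempty model of an `L.sum L'`-theory. -/
structure ModelOf (T₀ : (L.sum L').Theory) : Type 1 where
  carrier : Type
  [str : L.Structure carrier]
  [str' : L'.Structure carrier]
  [nonempty : Nonempty carrier]
  models : carrier ⊨ T₀

instance (T₀ : (L.sum L').Theory) : CoeSort (ModelOf T₀) Type := ⟨ModelOf.carrier⟩

attribute [instance] ModelOf.str ModelOf.str' ModelOf.nonempty

/-- Compactness for families of formulas over a theory. -/
theorem exists_realize_of_finset (T₀ : (L.sum L').Theory) {A I : Type}
    (Φ : I → (L.sum L').Formula A)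
    (h : ∀ s : Finset I, ∃ (W : ModelOf T₀) (f : A → W), ∀ i ∈ s, (Φ i).Realize f) :
    ∃ (W : ModelOf T₀) (f : A → W), ∀ i, (Φ i).Realize f := by
  choose W f hf using h
  let u : Ultrafilter (Finset I) := Ultrafilter.of Filter.atTop
  let P := (u : Filter (Finset I)).Product (fun s => (W s : Type))
  have hS : sumStructure L L' P = Ultraproduct.structure := by
    ext n f
    · cases f <;> rfl
    · cases f <;> rfl
  have hmod : P ⊨ T₀ := by
    rw [hS]
    refine (@Theory.model_iff _ P Ultraproduct.structure T₀).2 fun φ hφ =>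
      (Ultraproduct.sentence_realize φ).2 ?_
    exact Filter.Eventually.of_forall fun s => (W s).models.realize_of_mem φ hφ
  refine ⟨⟨P, hmod⟩, fun a => ((fun s => f s a : ∀ s, W s) : P), fun i => ?_⟩
  change @Formula.Realize _ P (sumStructure L L' P) _ (Φ i) _
  rw [hS]
  refine (Ultraproduct.realize_formula_cast (Φ i) fun a s => f s a).2 ?_
  refine Filter.Eventually.filter_mono (Ultrafilter.of_le _) ?_
  filter_upwards [Filter.eventually_ge_atTop {i}] with s hs
  exact hf s i (hs (Finset.mem_singleton_self _))

/-- A map preserving quantifier-free formulas is an embedding. -/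
theorem exists_embedding_of_forall_qf {ℒ : FirstOrder.Language.{0,0}} {M W : Type}
    [ℒ.Structure M] [ℒ.Structure W] (j : M → W)
    (h : ∀ φ : ℒ.Formula M, φ.IsQF → φ.Realize id → φ.Realize j) :
    ∃ e : M ↪[ℒ] W, ⇑e = j := by
  refine ⟨⟨⟨j, ?_⟩, ?_, ?_⟩, rfl⟩
  · intro x y hxy
    by_contra hne
    have := h (∼((Term.var x).equal (Term.var y)))
      (BoundedFormula.IsAtomic.equal _ _).isQF.not (by simpa [Formula.realize_not] using hne)
    simp [Formula.realize_not] at this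
    exact this hxy
  · intro n f x
    have := h ((Term.func f fun i => Term.var (x i)).equal (Term.var (Structure.funMap f x)))
      (BoundedFormula.IsAtomic.equal _ _).isQF (by simp)
    simp at this
    exact this.symm
  · intro n R x
    have h1 := h (R.formula fun i => Term.var (x i)) (BoundedFormula.IsAtomic.rel _ _).isQF
    have h2 := h (∼(R.formula fun i => Term.var (x i))) (BoundedFormula.IsAtomic.rel _ _).isQF.not
    simp only [Formula.realize_not, Formula.realize_rel, Term.realize_var] at h1 h2
    exact ⟨fun hR => by_contra fun hn => h2 hn hR, h1⟩

theorem realize_qf_embedding {ℒ : FirstOrder.Language.{0,0}} {M W α : Type}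
    [ℒ.Structure M] [ℒ.Structure W] (e : M ↪[ℒ] W) {φ : ℒ.Formula α} (hφ : φ.IsQF) (v : α → M) :
    φ.Realize (e ∘ v) ↔ φ.Realize v := by
  have := hφ.realize_embedding e (v := v) (xs := default)
  rw [Formula.Realize, Formula.Realize, ← this]
  exact iff_of_eq (congrArg _ (Subsingleton.elim _ _))

theorem isQF_relabel {ℒ : FirstOrder.Language.{0,0}} {α β : Type} {φ : ℒ.Formula α}
    (hφ : φ.IsQF) (g : α → β) : BoundedFormula.IsQF (φ.relabel g) :=
  BoundedFormula.IsQF.relabel hφ _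

/-- The `L`-reduct of an embedding of `(L.sum L')`-structures. -/
def reductEmbedding {M W : Type} [L.Structure M] [L'.Structure M] [L.Structure W]
    [L'.Structure W] (e : M ↪[L.sum L'] W) : M ↪[L] W where
  toFun := e
  inj' := e.injective
  map_fun' f x := e.map_fun (Sum.inl f : (L.sum L').Functions _) x
  map_rel' R x := e.map_rel (Sum.inl R : (L.sum L').Relations _) x

theorem models_left {T : L.Theory} {T₀ : (L.sum L').Theory}
    (hTT₀ : (LHom.sumInl : L →ᴸ L.sum L').onTheory T ⊆ T₀) {W : Type} [L.Structure W]
    [L'.Structure W] (hW : W ⊨ T₀) : W ⊨ T :=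
  (LHom.onTheory_model (LHom.sumInl : L →ᴸ L.sum L') T).1 (hW.mono hTT₀)

/-- Quantifier elimination: embeddings of nonempty models are elementary. -/
theorem HasQE.exists_elementary {T : L.Theory} (hqe : HasQE L T) {M W : Type}
    [L.Structure M] [L.Structure W] [Nonempty M] (hM : M ⊨ T) (hW : W ⊨ T)
    (e : M ↪[L] W) : ∃ e' : M ↪ₑ[L] W, ⇑e' = e := by
  have : Nonempty W := Nonempty.map e inferInstance
  refine ⟨⟨e, fun n φ x => ?_⟩, rfl⟩
  obtain ⟨ψ, hψ, hi⟩ := hqe n φ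
  have hM' := hi.realize_formula M (v := x)
  have hW' := hi.realize_formula W (v := e ∘ x)
  rw [Formula.realize_iff] at hM' hW'
  rw [hM', hW', realize_qf_embedding e hψ]

theorem UniversalTheoryModulo.models_of_embedding {T : L.Theory} {T₀ : (L.sum L').Theory}
    (hTT₀ : (LHom.sumInl : L →ᴸ L.sum L').onTheory T ⊆ T₀)
    (huniv : UniversalTheoryModulo L L' T T₀) {M W : Type} [L.Structure M] [L'.Structure M]
    [L.Structure W] [L'.Structure W] (hM : M ⊨ T) (hW : W ⊨ T₀) (e : M ↪[L.sum L'] W) :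
    M ⊨ T₀ := by
  refine ⟨fun φ hφ => ?_⟩
  obtain ⟨ψ, hψ, h⟩ := huniv φ hφ
  rw [h M hM]
  have := (h W (models_left hTT₀ hW)).1 (hW.realize_of_mem φ hφ)
  refine hψ.realize_embedding e ?_
  rw [Subsingleton.elim (e ∘ (default : Empty → M)) default,
    Subsingleton.elim (e ∘ (default : Fin 0 → M)) default]
  exact this

end Basics

section Extensions

variable {T₀ : (L.sum L').Theory}

/-- A set of quantifier-free formulas over `U` is jointly solvable if all its members have
solutions in a single extension of `U`. -/
def JointlySolvable (U : ModelOf T₀)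
    (S : Set (Σ n, {φ : (L.sum L').Formula (U ⊕ Fin n) // φ.IsQF})) : Prop :=
  ∃ (W : ModelOf T₀) (j : U ↪[L.sum L'] W), ∀ i ∈ S, ∃ x : Fin i.1 → W,
    i.2.1.Realize (Sum.elim j x)

theorem isOfFiniteCharacter_jointlySolvable (U : ModelOf T₀) :
    Order.IsOfFiniteCharacter {S | JointlySolvable U S} := by
  classical
  refine fun S => ⟨fun ⟨W, j, h⟩ S' hS' _ => ⟨W, j, fun i hi => h i (hS' hi)⟩, fun h => ?_⟩
  obtain ⟨W, f, hf⟩ := exists_realize_of_finset T₀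
    (A := U ⊕ Σ i : S, Fin i.1.1)
    (I := {φ : (L.sum L').Formula U // φ.IsQF ∧ φ.Realize id} ⊕ S)
    (Sum.elim (fun φ => φ.1.relabel Sum.inl)
      fun i => i.1.2.1.relabel (Sum.map id fun k => ⟨i, k⟩)) (by
    intro s
    let S' : Set (Σ n, {φ : (L.sum L').Formula (U ⊕ Fin n) // φ.IsQF}) :=
      (fun i : S => i.1) '' {i : S | Sum.inr i ∈ s}
    have hfin : {i : S | (Sum.inr i : {φ : (L.sum L').Formula U // φ.IsQF ∧ φ.Realize id} ⊕ S)
        ∈ s}.Finite := s.finite_toSet.preimage Sum.inr_injective.injOn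
    obtain ⟨W, j, hj⟩ := h S' (by rintro _ ⟨i, -, rfl⟩; exact i.2) (hfin.image _)
    choose x hx using fun (i : S) (hi : Sum.inr i ∈ s) => hj i.1 ⟨i, hi, rfl⟩
    refine ⟨W, Sum.elim j fun p => if hp : Sum.inr p.1 ∈ s then x p.1 hp p.2 else
      Classical.arbitrary W, ?_⟩
    rintro (φ | i) hi
    · simp only [Sum.elim_inl, Formula.realize_relabel, Sum.elim_comp_inl]
      exact (realize_qf_embedding j φ.2.1 id).2 φ.2.2
    · simp only [Sum.elim_inr, Formula.realize_relabel]
      convert hx i hi using 1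
      ext (u | k)
      · rfl
      · simp [hi])
  obtain ⟨e, he⟩ := exists_embedding_of_forall_qf (ℒ := L.sum L') (f ∘ Sum.inl)
    fun φ h1 h2 => Formula.realize_relabel.1 (hf (Sum.inl ⟨φ, h1, h2⟩))
  refine ⟨W, e, fun i hi => ⟨fun k => f (Sum.inr ⟨⟨i, hi⟩, k⟩), ?_⟩⟩
  have := hf (Sum.inr ⟨i, hi⟩)
  simp only [Sum.elim_inr, Formula.realize_relabel] at this
  convert this using 1
  rw [he]
  ext (u | k) <;> rfl

/-- Every model has an extension solving all quantifier-free formulas over it that are solvable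
in further extensions. -/
theorem exists_extension_solving (U : ModelOf T₀) :
    ∃ (V : ModelOf T₀) (e : U ↪[L.sum L'] V), ∀ (n : ℕ) (φ : (L.sum L').Formula (U ⊕ Fin n)),
      φ.IsQF → (∃ (W : ModelOf T₀) (j : V ↪[L.sum L'] W) (x : Fin n → W),
        φ.Realize (Sum.elim (j ∘ e) x)) → ∃ x : Fin n → V, φ.Realize (Sum.elim e x) := by
  obtain ⟨S, -, hS⟩ := (isOfFiniteCharacter_jointlySolvable U).exists_maximal
    (x := ∅) ⟨U, Embedding.refl _ _, by simp⟩
  obtain ⟨V, e, he⟩ := hS.prop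
  refine ⟨V, e, fun n φ hφ ⟨W, j, x, hx⟩ => he ⟨n, φ, hφ⟩ ?_⟩
  have : JointlySolvable U (insert ⟨n, φ, hφ⟩ S) := by
    refine ⟨W, j.comp e, ?_⟩
    rintro i (rfl | hi)
    · exact ⟨x, hx⟩
    · obtain ⟨y, hy⟩ := he i hi
      refine ⟨j ∘ y, ?_⟩
      have := (realize_qf_embedding j i.2.2 _).2 hy
      rwa [Sum.comp_elim] at this
  exact hS.le_of_ge this (Set.subset_insert _ _) (Set.mem_insert _ _)

/-- Every model has an extension realizing all one-variable `L`-types over it. -/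
theorem exists_extension_realizing (U : ModelOf T₀) :
    ∃ (V : ModelOf T₀) (e : U ↪[L.sum L'] V), ∀ p : Set (L.Formula (U ⊕ Fin 1)),
      (∀ s : Finset (L.Formula (U ⊕ Fin 1)), ↑s ⊆ p →
        ∃ x : U, ∀ χ ∈ s, χ.Realize (Sum.elim id fun _ => x)) →
      ∃ x : V, ∀ χ ∈ p, χ.Realize (Sum.elim e fun _ => x) := by
  classical
  let P := {p : Set (L.Formula (U ⊕ Fin 1)) // ∀ s : Finset (L.Formula (U ⊕ Fin 1)), ↑s ⊆ p →
        ∃ x : U, ∀ χ ∈ s, χ.Realize (Sum.elim id fun _ => x)}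
  obtain ⟨W, f, hf⟩ := exists_realize_of_finset T₀
    (A := U ⊕ P)
    (I := {φ : (L.sum L').Formula U // φ.Realize id} ⊕ Σ p : P, p.1)
    (Sum.elim (fun φ => φ.1.relabel Sum.inl)
      fun i => LHom.sumInl.onFormula (i.2.1.relabel (Sum.map id fun _ => i.1))) (by
    intro s
    have hfin : ∀ p : P, {i : p.1 |
        (Sum.inr ⟨p, i⟩ : {φ : (L.sum L').Formula U // φ.Realize id} ⊕ Σ p : P, p.1)
        ∈ s}.Finite := fun p => s.finite_toSet.preimage
          fun _ _ _ _ h => by simpa using h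
    choose x hx using fun p : P => p.2 ((hfin p).toFinset.map (Function.Embedding.subtype _)) (by
      intro χ hχ
      simp only [Finset.coe_map, Set.mem_image] at hχ
      obtain ⟨i, -, rfl⟩ := hχ
      exact i.2)
    refine ⟨U, Sum.elim id x, ?_⟩
    rintro (φ | ⟨p, i⟩) hi
    · simp only [Sum.elim_inl, Formula.realize_relabel, Sum.elim_comp_inl]
      exact φ.2
    · simp only [Sum.elim_inr, LHom.realize_onFormula, Formula.realize_relabel]
      convert hx p i.1 (Finset.mem_map_of_mem _ (by simpa using hi)) using 1
      ext (u | k) <;> rfl)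
  obtain ⟨e, he⟩ := exists_embedding_of_forall_qf (ℒ := L.sum L') (f ∘ Sum.inl)
    fun φ _ h2 => Formula.realize_relabel.1 (hf (Sum.inl ⟨φ, h2⟩))
  refine ⟨W, e, fun p hp => ⟨f (Sum.inr ⟨p, hp⟩), fun χ hχ => ?_⟩⟩
  have := hf (Sum.inr ⟨⟨p, hp⟩, ⟨χ, hχ⟩⟩)
  simp only [Sum.elim_inr, LHom.realize_onFormula, Formula.realize_relabel] at this
  convert this using 1
  rw [he]
  ext (u | k) <;> rfl

end Extensions

section Chains

variable {T₀ : (L.sum L').Theory}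

/-- `V` is the union of the chain `G` of models, with inclusions `e` and bonding maps `f`. -/
structure IsChainUnion (G : ℕ → ModelOf T₀) (f : ∀ n, G n ↪[L.sum L'] G (n + 1)) (V : Type)
    [L.Structure V] [L'.Structure V] (e : ∀ n, G n ↪[L.sum L'] V) : Prop where
  map_succ : ∀ n x, e (n + 1) (f n x) = e n x
  exists_eq : ∀ z, ∃ n x, e n x = z

theorem exists_isChainUnion (G : ℕ → ModelOf T₀) (f : ∀ n, G n ↪[L.sum L'] G (n + 1)) :
    ∃ (V : Type) (_ : L.Structure V) (_ : L'.Structure V) (e : ∀ n, G n ↪[L.sum L'] V),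
      IsChainUnion G f V e := by
  let V := DirectLimit (L := L.sum L') (fun n => (G n : Type)) (DirectedSystem.natLERec f)
  let S : (L.sum L').Structure V := DirectLimit.instStructureDirectLimit _ _
  obtain ⟨iL, iL', hS⟩ := exists_sumStructure_eq V S
  have key : ∀ S' : (L.sum L').Structure V, S' = S →
      ∃ e : ∀ n, G n ↪[L.sum L'] V,
        (∀ n x, e (n + 1) (f n x) = e n x) ∧ ∀ z, ∃ n x, e n x = z := by
    rintro _ rfl
    refine ⟨fun n => DirectLimit.of (L.sum L') ℕ (fun n => (G n : Type))
      (DirectedSystem.natLERec f) n, fun n x => ?_, fun z => DirectLimit.exists_of z⟩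
    have := DirectLimit.of_f (L := L.sum L') (G := fun n => (G n : Type))
      (f := DirectedSystem.natLERec f) (hij := n.le_succ) (x := x)
    rw [DirectedSystem.coe_natLERec] at this
    beta_reduce at this
    rwa [Nat.leRecOn_succ'] at this
  obtain ⟨e, h1, h2⟩ := key _ hS
  exact ⟨V, iL, iL', e, h1, h2⟩

namespace IsChainUnion

variable {G : ℕ → ModelOf T₀} {f : ∀ n, G n ↪[L.sum L'] G (n + 1)} {V : Type}
    [L.Structure V] [L'.Structure V] {e : ∀ n, G n ↪[L.sum L'] V}

theorem exists_embedding (h : IsChainUnion G f V e) {n m : ℕ} (hnm : n ≤ m) :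
    ∃ g : G n ↪[L.sum L'] G m, ∀ x, e m (g x) = e n x := by
  induction m, hnm using Nat.le_induction with
  | base => exact ⟨Embedding.refl _ _, fun _ => rfl⟩
  | succ m _ ih =>
    obtain ⟨g, hg⟩ := ih
    exact ⟨(f m).comp g, fun x => (h.map_succ m (g x)).trans (hg x)⟩

theorem exists_tuple (h : IsChainUnion G f V e) {ι : Type} [Finite ι] (z : ι → V) :
    ∃ n x, e n ∘ x = z := by
  choose n x hx using fun i => h.exists_eq (z i)
  obtain ⟨m, hm⟩ := Finite.bddAbove_range n
  choose g hg using fun i => h.exists_embedding (hm ⟨i, rfl⟩)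
  exact ⟨m, fun i => g i (x i), funext fun i => (hg i _).trans (hx i)⟩

theorem realize_iff (h : IsChainUnion G f V e) {T : L.Theory} (hqe : HasQE L T)
    (hTT₀ : (LHom.sumInl : L →ᴸ L.sum L').onTheory T ⊆ T₀) {α : Type} {k : ℕ}
    (φ : L.BoundedFormula α k) (n : ℕ) (v : α → G n) (xs : Fin k → G n) :
    φ.Realize (e n ∘ v) (e n ∘ xs) ↔ φ.Realize v xs := by
  induction φ generalizing n with
  | falsum => rfl
  | equal t₁ t₂ =>
    exact (BoundedFormula.IsAtomic.equal t₁ t₂).isQF.realize_embedding (reductEmbedding (e n))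
  | rel R ts =>
    exact (BoundedFormula.IsAtomic.rel R ts).isQF.realize_embedding (reductEmbedding (e n))
  | imp φ ψ ih₁ ih₂ => simp only [BoundedFormula.realize_imp, ih₁, ih₂]
  | all φ ih =>
    simp only [BoundedFormula.realize_all]
    refine ⟨fun hr a => ?_, fun hr z => ?_⟩
    · rw [← ih, Fin.comp_snoc]
      exact hr _
    · obtain ⟨m, a, rfl⟩ := h.exists_eq z
      obtain ⟨g₁, hg₁⟩ := h.exists_embedding (le_max_left n m)
      obtain ⟨g₂, hg₂⟩ := h.exists_embedding (le_max_right n m)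
      obtain ⟨g, hg⟩ := hqe.exists_elementary (models_left hTT₀ (G n).models)
        (models_left hTT₀ (G (max n m)).models) (reductEmbedding g₁)
      replace hg : ∀ x, e (max n m) (g x) = e n x := fun x => by rw [hg]; exact hg₁ x
      have h1 := (g.map_boundedFormula φ.all v xs).2 (BoundedFormula.realize_all.2 hr)
      have h2 := (ih _ _ _).2 (BoundedFormula.realize_all.1 h1 (g₂ a))
      rw [Fin.comp_snoc, ← Function.comp_assoc, ← Function.comp_assoc, hg₂] at h2
      rwa [show e (max n m) ∘ g = e n from funext hg] at h2

theorem realize_of_isUniversal (h : IsChainUnion G f V e) {α : Type} {k : ℕ}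
    {φ : (L.sum L').BoundedFormula α k} (hφ : φ.IsUniversal) (n : ℕ) (v : α → G n)
    (xs : Fin k → G n) (hr : ∀ m, n ≤ m → ∀ g : G n ↪[L.sum L'] G m, 
      (∀ x, e m (g x) = e n x) → φ.Realize (g ∘ v) (g ∘ xs)) :
    φ.Realize (e n ∘ v) (e n ∘ xs) := by
  induction hφ generalizing n with
  | of_isQF hφ =>
    exact (hφ.realize_embedding (e n)).2 (hr n le_rfl (Embedding.refl _ _) fun _ => rfl)
  | all hφ ih =>
    refine BoundedFormula.realize_all.2 fun z => ?_
    obtain ⟨m, a, rfl⟩ := h.exists_eq z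
    obtain ⟨g₁, hg₁⟩ := h.exists_embedding (le_max_left n m)
    obtain ⟨g₂, hg₂⟩ := h.exists_embedding (le_max_right n m)
    have := ih (max n m) (g₁ ∘ v) (Fin.snoc (g₁ ∘ xs) (g₂ a)) fun k hk g hg => by
      have := BoundedFormula.realize_all.1 (hr k ((le_max_left _ _).trans hk) (g.comp g₁)
        fun x => (hg _).trans (hg₁ x)) (g (g₂ a))
      rw [Fin.comp_snoc]
      exact this
    rw [Fin.comp_snoc, ← Function.comp_assoc, ← Function.comp_assoc, hg₂] at this
    rwa [show e (max n m) ∘ g₁ = e n from funext hg₁] at this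

theorem models (h : IsChainUnion G f V e) {T : L.Theory} (hqe : HasQE L T)
    (hTT₀ : (LHom.sumInl : L →ᴸ L.sum L').onTheory T ⊆ T₀)
    (huniv : UniversalTheoryModulo L L' T T₀) : V ⊨ T₀ := by
  have hV : V ⊨ T := ⟨fun φ hφ => by
    have := (h.realize_iff hqe hTT₀ φ 0 default default).2
      ((models_left hTT₀ (G 0).models).realize_of_mem φ hφ)
    rwa [Subsingleton.elim (e 0 ∘ (default : Empty → G 0)) default,
      Subsingleton.elim (e 0 ∘ (default : Fin 0 → G 0)) default] at this⟩
  refine ⟨fun φ hφ => ?_⟩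
  obtain ⟨ψ, hψ, hi⟩ := huniv φ hφ
  rw [hi V hV]
  have := h.realize_of_isUniversal hψ 0 default default fun m _ g _ => by
    rw [Subsingleton.elim (g ∘ (default : Empty → G 0)) default,
      Subsingleton.elim (g ∘ (default : Fin 0 → G 0)) default]
    exact (hi (G m) (models_left hTT₀ (G m).models)).1 ((G m).models.realize_of_mem φ hφ)
  rwa [Subsingleton.elim (e 0 ∘ (default : Empty → G 0)) default,
    Subsingleton.elim (e 0 ∘ (default : Fin 0 → G 0)) default] at this

end IsChainUnion

end Chains

section SameType

variable {M W : Type} [L.Structure M] [L.Structure W]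

variable (L) in
/-- The tuples `a` and `u` have the same complete parameter-free `L`-type. -/
def SameType {ι : Type} (a : ι → M) (u : ι → W) : Prop :=
  ∀ φ : L.Formula ι, φ.Realize a ↔ φ.Realize u

theorem SameType.symm {ι : Type} {a : ι → M} {u : ι → W} (h : SameType L a u) :
    SameType L u a :=
  fun φ => (h φ).symm

theorem SameType.trans {P ι : Type} [L.Structure P] {a : ι → M} {u : ι → W} {c : ι → P}
    (h : SameType L a u) (h' : SameType L u c) : SameType L a c :=
  fun φ => (h φ).trans (h' φ)

theorem SameType.comp {ι κ : Type} {a : ι → M} {u : ι → W} (h : SameType L a u) (g : κ → ι) :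
    SameType L (a ∘ g) (u ∘ g) := fun φ => by
  simpa only [Formula.realize_relabel] using h (φ.relabel g)

theorem sameType_elementary {ι : Type} (e : M ↪ₑ[L] W) (a : ι → M) :
    SameType L a (e ∘ a) :=
  fun φ => (e.map_formula φ a).symm

theorem SameType.exists_finset {ι κ : Type} [Finite κ] {a : ι → M} {u : ι → W}
    (h : SameType L a u) (s : Finset (L.Formula (ι ⊕ κ)))
    (hs : ∃ x : κ → M, ∀ χ ∈ s, χ.Realize (Sum.elim a x)) :
    ∃ x : κ → W, ∀ χ ∈ s, χ.Realize (Sum.elim u x) := by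
  have := h ((Formula.iInf fun χ : s => χ.1).iExs κ)
  simp only [Formula.realize_iExs, Formula.realize_iInf, Subtype.forall] at this
  exact this.1 hs

end SameType

section ECExtension

variable {T : L.Theory} {T₀ : (L.sum L').Theory}

theorem exists_extension_solving_realizing (hqe : HasQE L T)
    (hTT₀ : (LHom.sumInl : L →ᴸ L.sum L').onTheory T ⊆ T₀) (U : ModelOf T₀) :
    ∃ (V : ModelOf T₀) (e : U ↪[L.sum L'] V),
      (∀ (n : ℕ) (φ : (L.sum L').Formula (U ⊕ Fin n)),
        φ.IsQF → (∃ (W : ModelOf T₀) (j : V ↪[L.sum L'] W) (x : Fin n → W),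
          φ.Realize (Sum.elim (j ∘ e) x)) → ∃ x : Fin n → V, φ.Realize (Sum.elim e x)) ∧
      ∀ p : Set (L.Formula (U ⊕ Fin 1)),
        (∀ s : Finset (L.Formula (U ⊕ Fin 1)), ↑s ⊆ p →
          ∃ x : Fin 1 → U, ∀ χ ∈ s, χ.Realize (Sum.elim id x)) →
        ∃ x : V, ∀ χ ∈ p, χ.Realize (Sum.elim e fun _ => x) := by
  classical
  obtain ⟨U₁, e₁, h₁⟩ := exists_extension_solving U
  obtain ⟨V, e₂, h₂⟩ := exists_extension_realizing U₁
  refine ⟨V, e₂.comp e₁, ?_, ?_⟩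
  · rintro n φ hφ ⟨W, j, x, hx⟩
    obtain ⟨y, hy⟩ := h₁ n φ hφ ⟨W, j.comp e₂, x, hx⟩
    refine ⟨e₂ ∘ y, ?_⟩
    have := (realize_qf_embedding e₂ hφ _).2 hy
    rwa [Sum.comp_elim] at this
  · intro p hp
    obtain ⟨g, hg⟩ := hqe.exists_elementary (models_left hTT₀ U.models)
      (models_left hTT₀ U₁.models) (reductEmbedding e₁)
    replace hg : ⇑g = e₁ := hg
    obtain ⟨x, hx⟩ := h₂ ((fun χ => χ.relabel (Sum.map e₁ id)) '' p) (by
      intro s hs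
      obtain ⟨s', hs', rfl⟩ := Finset.subset_set_image_iff.1 hs
      obtain ⟨x, hx⟩ := (sameType_elementary g id).exists_finset s' (hp s' hs')
      refine ⟨x 0, fun χ hχ => ?_⟩
      obtain ⟨χ', hχ', rfl⟩ := Finset.mem_image.1 hχ
      rw [Formula.realize_relabel]
      convert hx χ' hχ' using 1
      rw [hg]
      ext (u | k)
      · rfl
      · simp [Subsingleton.elim k 0])
    refine ⟨x, fun χ hχ => ?_⟩
    have := hx _ (Set.mem_image_of_mem _ hχ)
    rw [Formula.realize_relabel] at this
    convert this using 1
    ext (u | k) <;> rfl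

/-- Every nonempty model of `T₀` extends to an existentially closed model with saturated
`L`-reduct. -/
theorem exists_extension_ec_saturated (hqe : HasQE L T)
    (hTT₀ : (LHom.sumInl : L →ᴸ L.sum L').onTheory T ⊆ T₀)
    (huniv : UniversalTheoryModulo L L' T T₀) (U : ModelOf T₀) :
    ∃ (V : ModelOf T₀) (_ : U ↪[L.sum L'] V), IsECModel L L' T₀ V ∧ IsSaturated L V := by
  classical
  choose S e hsolve hreal using exists_extension_solving_realizing (T₀ := T₀) hqe hTT₀
  let G : ℕ → ModelOf T₀ := fun n => Nat.rec U (fun _ => S) n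
  obtain ⟨V, iL, iL', i, h⟩ := exists_isChainUnion G fun n => e (G n)
  have hV : V ⊨ T₀ := h.models hqe hTT₀ huniv
  have hne : Nonempty V := U.nonempty.map (i 0)
  refine ⟨⟨V, hV⟩, i 0, ⟨hV, ?_⟩, ?_⟩
  · rintro k n φ c hφ ⟨W, iW, iW', j, hW, x, hx⟩
    obtain ⟨m, c, rfl⟩ := h.exists_tuple c
    have : Nonempty W := hne.map j
    obtain ⟨y, hy⟩ := hsolve (G m) n (φ.relabel (Sum.map c id)) (isQF_relabel hφ _)
      ⟨⟨W, hW⟩, j.comp (i (m + 1)), x, by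
        rw [Formula.realize_relabel]
        convert hx using 1
        ext (u | k)
        · exact congrArg j (h.map_succ m (c u))
        · rfl⟩
    refine ⟨i (m + 1) ∘ y, ?_⟩
    rw [Formula.realize_relabel] at hy
    have := (realize_qf_embedding (i (m + 1)) hφ _).2 hy
    convert this using 1
    ext (u | k)
    · exact (h.map_succ m (c u)).symm
    · rfl
  · intro k c p hp
    obtain ⟨m, c, rfl⟩ := h.exists_tuple c
    have hst (m : ℕ) {ι : Type} (a : ι → G m) : SameType L a (i m ∘ a) := fun φ => by
      rw [Formula.Realize, Formula.Realize, ← h.realize_iff hqe hTT₀,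
        Subsingleton.elim (i m ∘ (default : Fin 0 → G m)) default]
    obtain ⟨x, hx⟩ := hreal (G m) ((fun χ => χ.relabel (Sum.map c id)) '' p) (by
      intro s hs
      obtain ⟨s', hs', rfl⟩ := Finset.subset_set_image_iff.1 hs
      obtain ⟨z, hz⟩ := hp s' hs'
      obtain ⟨x, hx⟩ := (hst m c).symm.exists_finset s' ⟨_, hz⟩
      refine ⟨x, fun χ hχ => ?_⟩
      obtain ⟨χ', hχ', rfl⟩ := Finset.mem_image.1 hχ
      rw [Formula.realize_relabel]
      convert hx χ' hχ' using 1
      ext (u | k) <;> rfl)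
    refine ⟨i (m + 1) x, fun χ hχ => ?_⟩
    have := hx _ (Set.mem_image_of_mem _ hχ)
    rw [Formula.realize_relabel] at this
    convert (hst (m + 1) _ χ).1 this using 1
    ext (u | k)
    · exact (h.map_succ m (c u)).symm
    · rfl

end ECExtension

section BackAndForth

variable {M W : Type} [L.Structure M] [L.Structure W]

theorem SameType.exists_extend_one (hW : IsSaturated L W) {ι : Type} [Finite ι] {a : ι → M}
    {u : ι → W} (h : SameType L a u) (x : M) :
    ∃ w : W, SameType L (Sum.elim a fun _ : Fin 1 => x) (Sum.elim u fun _ : Fin 1 => w) := by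
  obtain ⟨k, ⟨ε⟩⟩ := Finite.exists_equiv_fin ι
  let a' : Fin k ⊕ Fin 1 → M := Sum.elim (a ∘ ε.symm) fun _ => x
  obtain ⟨w, hw⟩ := hW k (u ∘ ε.symm) {φ | φ.Realize a'} fun s hs => by
    obtain ⟨w, hw⟩ := (h.comp ε.symm).exists_finset s ⟨fun _ : Fin 1 => x, fun χ hχ => hs hχ⟩
    refine ⟨w 0, fun χ hχ => ?_⟩
    convert hw χ hχ using 2
    exact funext fun i => congrArg w (Subsingleton.elim _ _)
  have key : SameType L a' (Sum.elim (u ∘ ε.symm) fun _ : Fin 1 => w) := fun φ =>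
    ⟨fun hφ => hw φ hφ, fun hφ => by_contra fun hn => hw (∼φ) hn hφ⟩
  refine ⟨w, ?_⟩
  convert key.comp (Sum.map ε id) using 1 <;>
  · ext (i | i) <;> simp [a']

theorem SameType.exists_extend (hW : IsSaturated L W) {ι : Type} [Finite ι] {a : ι → M}
    {u : ι → W} (h : SameType L a u) {n : ℕ} (x : Fin n → M) :
    ∃ w : Fin n → W, SameType L (Sum.elim a x) (Sum.elim u w) := by
  induction n with
  | zero =>
    refine ⟨Fin.elim0, ?_⟩
    convert h.comp (Sum.elim id Fin.elim0 : ι ⊕ Fin 0 → ι) using 1 <;>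
    · ext (i | i)
      · rfl
      · exact i.elim0
  | succ n ih =>
    obtain ⟨w, hw⟩ := ih (x ∘ Fin.castSucc)
    obtain ⟨z, hz⟩ := hw.exists_extend_one hW (x (Fin.last n))
    refine ⟨Fin.snoc w z, ?_⟩
    convert hz.comp (Sum.elim (Sum.inl ∘ Sum.inl) fun i : Fin (n + 1) =>
      Fin.lastCases (motive := fun _ => (ι ⊕ Fin n) ⊕ Fin 1) (Sum.inr 0)
        (fun i => Sum.inl (Sum.inr i)) i) using 1 <;>
    · ext (i | i)
      · rfl
      · refine Fin.lastCases ?_ (fun i => ?_) i <;> simp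

theorem SameType.eq_iff {ι : Type} {a : ι → M} {u : ι → W} (h : SameType L a u) (i j : ι) :
    a i = a j ↔ u i = u j := by
  simpa using h ((Term.var i).equal (Term.var j))

variable (L M W) in
/-- Finite partial elementary maps from `M` to `W`. -/
def FinPartial : Type :=
  {r : Finset (M × W) // SameType L (fun i : r => i.1.1) (fun i : r => i.1.2)}

instance : PartialOrder (FinPartial L M W) := inferInstanceAs (PartialOrder (Subtype _))

namespace FinPartial

theorem sameType (r : FinPartial L M W) {ι : Type} {a : ι → M} {u : ι → W}
    (h : ∀ i, (a i, u i) ∈ r.1) : SameType L a u :=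
  r.2.comp fun i => ⟨(a i, u i), h i⟩

theorem exists_insert (r : FinPartial L M W) {x : M} {w : W}
    (h : SameType L (Sum.elim (fun i : r.1 => i.1.1) fun _ : Fin 1 => x)
      (Sum.elim (fun i : r.1 => i.1.2) fun _ : Fin 1 => w)) :
    ∃ r' : FinPartial L M W, r ≤ r' ∧ (x, w) ∈ r'.1 := by
  classical
  refine ⟨⟨insert (x, w) r.1, ?_⟩, Finset.subset_insert _ _, Finset.mem_insert_self _ _⟩
  convert h.comp fun i : (insert (x, w) r.1 : Finset (M × W)) =>
    if h : i.1 ∈ r.1 then Sum.inl ⟨i.1, h⟩ else Sum.inr 0 using 1 <;>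
  · ext ⟨i, hi⟩
    by_cases h : i ∈ r.1
    · simp [h]
    · obtain rfl := (Finset.mem_insert.1 hi).resolve_right h
      simp [h]

theorem exists_left (hW : IsSaturated L W) (r : FinPartial L M W) (x : M) :
    ∃ r' : FinPartial L M W, r ≤ r' ∧ ∃ w, (x, w) ∈ r'.1 := by
  obtain ⟨w, hw⟩ := r.2.exists_extend_one hW x
  obtain ⟨r', h, h'⟩ := r.exists_insert hw
  exact ⟨r', h, w, h'⟩

theorem exists_right (hM : IsSaturated L M) (r : FinPartial L M W) (w : W) :
    ∃ r' : FinPartial L M W, r ≤ r' ∧ ∃ x, (x, w) ∈ r'.1 := by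
  obtain ⟨x, hx⟩ := r.2.symm.exists_extend_one hM w
  obtain ⟨r', h, h'⟩ := r.exists_insert hx.symm
  exact ⟨r', h, x, h'⟩

theorem exists_left_tuple (hW : IsSaturated L W) (r : FinPartial L M W) {n : ℕ}
    (y : Fin n → M) :
    ∃ r' : FinPartial L M W, r ≤ r' ∧ ∃ w : Fin n → W, ∀ i, (y i, w i) ∈ r'.1 := by
  induction n with
  | zero => exact ⟨r, le_rfl, Fin.elim0, fun i => i.elim0⟩
  | succ n ih =>
    obtain ⟨r₁, h₁, w, hw⟩ := ih (y ∘ Fin.castSucc)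
    obtain ⟨r₂, h₂, z, hz⟩ := r₁.exists_left hW (y (Fin.last n))
    refine ⟨r₂, h₁.trans h₂, Fin.snoc w z, fun i => ?_⟩
    refine Fin.lastCases ?_ (fun i => ?_) i
    · simpa using hz
    · simpa using h₂ (hw i)

end FinPartial

/-- A finite partial elementary map between saturated structures with countable domain extends
to an elementary embedding whose range is closed under countably many given operations. -/
theorem SameType.exists_elementary_closed [Countable M] (hM : IsSaturated L M)
    (hW : IsSaturated L W) {J : Type} [Countable J] (n : J → ℕ)
    (B : ∀ j, (Fin (n j) → W) → W) {ι : Type} [Finite ι] {a : ι → M} {u : ι → W}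
    (h : SameType L a u) :
    ∃ g : M ↪ₑ[L] W, g ∘ a = u ∧ ∀ j (y : Fin (n j) → M), ∃ x, g x = B j (g ∘ y) := by
  classical
  have := Fintype.ofFinite ι
  let r₀ : FinPartial L M W := ⟨Finset.univ.image fun i => (a i, u i), by
    have hex : ∀ i : (Finset.univ.image fun i => (a i, u i)), ∃ k, (a k, u k) = i.1 :=
      fun ⟨i, hi⟩ => by simpa using hi
    choose f hf using hex
    convert h.comp f using 1 <;>
    · ext i
      simp [← hf]⟩
  let _ : Encodable (M ⊕ Σ j, Fin (n j) → M) := Encodable.ofCountable _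
  let D : (M ⊕ Σ j, Fin (n j) → M) → Order.Cofinal (FinPartial L M W) := Sum.elim
    (fun x => ⟨{r | ∃ w, (x, w) ∈ r.1}, fun r => by
      obtain ⟨r', h, h'⟩ := r.exists_left hW x
      exact ⟨r', h', h⟩⟩)
    fun p => ⟨{r | ∃ w, (∀ i, (p.2 i, w i) ∈ r.1) ∧ ∃ x, (x, B p.1 w) ∈ r.1}, fun r => by
      obtain ⟨r₁, h₁, w, hw⟩ := r.exists_left_tuple hW p.2
      obtain ⟨r₂, h₂, x, hx⟩ := r₁.exists_right hM (B p.1 w)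
      exact ⟨r₂, ⟨w, fun i => h₂ (hw i), x, hx⟩, h₁.trans h₂⟩⟩
  let R := Order.sequenceOfCofinals r₀ D
  have hR : Monotone R := Order.sequenceOfCofinals.monotone r₀ D
  have hmem (i) : ∃ m, R m ∈ D i := ⟨_, Order.sequenceOfCofinals.encode_mem r₀ D i⟩
  choose m hm using hmem
  choose g hg using fun x => hm (Sum.inl x)
  have huniq : ∀ {k x w}, (x, w) ∈ (R k).1 → g x = w := fun {k x w} hk => by
    have := (R (max k (m (Sum.inl x)))).sameType (ι := Bool) (a := fun _ => x)
      (u := fun i => if i then g x else w) (by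
        rintro (_ | _)
        · exact hR (le_max_left _ _) hk
        · exact hR (le_max_right _ _) (hg x))
    simpa using (this.eq_iff true false).1 rfl
  refine ⟨⟨g, fun k φ x => ?_⟩, funext fun i => ?_, fun j y => ?_⟩
  · obtain ⟨b, hb⟩ := Finite.bddAbove_range fun i => m (Sum.inl (x i))
    exact ((R b).sameType (fun i => hR (hb ⟨i, rfl⟩) (hg (x i))) φ).symm
  · exact huniq (k := 0) (Finset.mem_image_of_mem _ (Finset.mem_univ i))
  · obtain ⟨w, hw, x, hx⟩ := hm (Sum.inr ⟨j, y⟩)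
    refine ⟨x, (huniq hx).trans (congrArg (B j) ?_)⟩
    exact funext fun i => (huniq (hw i)).symm

/-- Countable saturated structures are homogeneous. -/
theorem SameType.exists_equiv [Countable N] (hN : IsSaturated L N) {ι : Type} [Finite ι]
    {a a' : ι → N} (h : SameType L a a') : ∃ g : N ≃[L] N, g ∘ a = a' := by
  obtain ⟨g, hg, hsurj⟩ := h.exists_elementary_closed hN hN (J := N) (fun _ => 0) fun x _ => x
  refine ⟨⟨Equiv.ofBijective g ⟨g.injective, fun x => hsurj x Fin.elim0⟩,
    fun f x => g.map_fun f x, fun R x => g.map_rel R x⟩, hg⟩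

end BackAndForth

section QuantifierFree

theorem isQF_iInf {ℒ : FirstOrder.Language.{0,0}} {α β : Type} [Finite β] {f : β → ℒ.Formula α}
    (h : ∀ b, (f b).IsQF) : BoundedFormula.IsQF (Formula.iInf f) := by
  have (l : List β) : BoundedFormula.IsQF ((l.map f).foldr (· ⊓ ·) (⊤ : ℒ.Formula α)) := by
    induction l with
    | nil => exact BoundedFormula.IsQF.top
    | cons b l ih => exact (h b).inf ih
  exact this _

theorem isQF_onBoundedFormula {ℒ ℒ' : FirstOrder.Language.{0,0}} (g : ℒ →ᴸ ℒ') {α : Type}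
    {n : ℕ} {φ : ℒ.BoundedFormula α n} (h : φ.IsQF) : (g.onBoundedFormula φ).IsQF := by
  induction h with
  | falsum => exact .falsum
  | of_isAtomic h =>
    cases h with
    | equal t₁ t₂ => exact (BoundedFormula.IsAtomic.equal _ _).isQF
    | rel R ts => exact (BoundedFormula.IsAtomic.rel _ _).isQF
  | imp _ _ ih₁ ih₂ => exact ih₁.imp ih₂

/-- The map `h` restricts to a partial isomorphism on the set `A`. -/
structure PartialIsoOn (ℒ : FirstOrder.Language.{0,0}) {W M : Type} [ℒ.Structure W]
    [ℒ.Structure M] (A : Set W) (h : W → M) : Prop where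
  injOn : Set.InjOn h A
  map_fun : ∀ {n} (f : ℒ.Functions n) (x : Fin n → W), (∀ i, x i ∈ A) →
    Structure.funMap f x ∈ A → h (Structure.funMap f x) = Structure.funMap f (h ∘ x)
  map_rel : ∀ {n} (R : ℒ.Relations n) (x : Fin n → W), (∀ i, x i ∈ A) →
    (Structure.RelMap R (h ∘ x) ↔ Structure.RelMap R x)

variable {ℒ : FirstOrder.Language.{0,0}} {W : Type} [ℒ.Structure W]

theorem PartialIsoOn.mono {M : Type} [ℒ.Structure M] {A B : Set W} {h : W → M}
    (hB : PartialIsoOn ℒ B h) (hAB : A ⊆ B) : PartialIsoOn ℒ A h :=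
  ⟨hB.injOn.mono hAB, fun f x hx hf => hB.map_fun f x (fun i => hAB (hx i)) (hAB hf),
    fun R x hx => hB.map_rel R x fun i => hAB (hx i)⟩

theorem exists_finite_realize_term {β : Type} (v : β → W) (t : ℒ.Term β) :
    ∃ A : Set W, A.Finite ∧ t.realize v ∈ A ∧ ∀ (M : Type) [ℒ.Structure M] (h : W → M),
      PartialIsoOn ℒ A h → t.realize (h ∘ v) = h (t.realize v) := by
  induction t with
  | var i => exact ⟨{v i}, Set.finite_singleton _, rfl, fun _ _ _ _ => rfl⟩
  | func f ts ih =>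
    choose A hA hmem hr using ih
    refine ⟨insert ((Term.func f ts).realize v) (⋃ i, A i), (Set.finite_iUnion hA).insert _,
      Set.mem_insert _ _, fun M _ h hh => ?_⟩
    have hsub (i) : A i ⊆ insert ((Term.func f ts).realize v) (⋃ i, A i) :=
      (Set.subset_iUnion A i).trans (Set.subset_insert _ _)
    rw [Term.realize, Term.realize, hh.map_fun f _ (fun i => hsub i (hmem i)) (Set.mem_insert _ _)]
    exact congrArg _ (funext fun i => hr i M h (hh.mono (hsub i)))

theorem exists_finite_realize_qf {α : Type} {n : ℕ} {φ : ℒ.BoundedFormula α n} (hφ : φ.IsQF)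
    (v : α → W) (xs : Fin n → W) :
    ∃ A : Set W, A.Finite ∧ ∀ (M : Type) [ℒ.Structure M] (h : W → M),
      PartialIsoOn ℒ A h → (φ.Realize (h ∘ v) (h ∘ xs) ↔ φ.Realize v xs) := by
  induction hφ with
  | falsum => exact ⟨∅, Set.finite_empty, fun _ _ _ _ => Iff.rfl⟩
  | of_isAtomic h =>
    cases h with
    | equal t₁ t₂ =>
      obtain ⟨A₁, h₁, m₁, r₁⟩ := exists_finite_realize_term (Sum.elim v xs) t₁
      obtain ⟨A₂, h₂, m₂, r₂⟩ := exists_finite_realize_term (Sum.elim v xs) t₂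
      refine ⟨A₁ ∪ A₂, h₁.union h₂, fun M _ h hh => ?_⟩
      rw [BoundedFormula.realize_bdEqual, BoundedFormula.realize_bdEqual, ← Sum.comp_elim,
        r₁ M h (hh.mono Set.subset_union_left), r₂ M h (hh.mono Set.subset_union_right)]
      exact hh.injOn.eq_iff (Or.inl m₁) (Or.inr m₂)
    | rel R ts =>
      choose A hA hmem hr using fun i => exists_finite_realize_term (Sum.elim v xs) (ts i)
      refine ⟨⋃ i, A i, Set.finite_iUnion hA, fun M _ h hh => ?_⟩
      rw [BoundedFormula.realize_rel, BoundedFormula.realize_rel, ← Sum.comp_elim,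
        ← hh.map_rel R _ fun i => Set.mem_iUnion_of_mem i (hmem i)]
      refine iff_of_eq (congrArg _ (funext fun i => hr i M h (hh.mono (Set.subset_iUnion A i))))
  | imp _ _ ih₁ ih₂ =>
    obtain ⟨A₁, h₁, r₁⟩ := ih₁
    obtain ⟨A₂, h₂, r₂⟩ := ih₂
    refine ⟨A₁ ∪ A₂, h₁.union h₂, fun M _ h hh => ?_⟩
    rw [BoundedFormula.realize_imp, BoundedFormula.realize_imp,
      r₁ M h (hh.mono Set.subset_union_left), r₂ M h (hh.mono Set.subset_union_right)]

/-- The atomic diagram of a finite tuple in a finite language, as a single formula. -/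
theorem exists_diagram_formula [Finite (Σ i, ℒ.Functions i)] [Finite (Σ i, ℒ.Relations i)]
    {k : ℕ} (e : Fin k → W) :
    ∃ δ : ℒ.Formula (Fin k), δ.IsQF ∧ δ.Realize e ∧
      ∀ (M : Type) [ℒ.Structure M] (e' : Fin k → M), δ.Realize e' →
        (∀ {n} (f : ℒ.Functions n) (x : Fin n → Fin k) (y : Fin k),
          Structure.funMap f (e ∘ x) = e y → Structure.funMap f (e' ∘ x) = e' y) ∧
        ∀ {n} (R : ℒ.Relations n) (x : Fin n → Fin k),
          Structure.RelMap R (e' ∘ x) ↔ Structure.RelMap R (e ∘ x) := by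
  classical
  let I := (Σ p : Σ n, ℒ.Functions n, (Fin p.1 → Fin k) × Fin k) ⊕
    (Σ p : Σ n, ℒ.Relations n, Fin p.1 → Fin k)
  let at' : I → ℒ.Formula (Fin k) := Sum.elim
    (fun i => (Term.func i.1.2 fun j => Term.var (i.2.1 j)).equal (Term.var i.2.2))
    fun i => i.1.2.formula fun j => Term.var (i.2 j)
  have hat (i) : (at' i).IsQF := by
    rcases i with i | i
    · exact (BoundedFormula.IsAtomic.equal _ _).isQF
    · exact (BoundedFormula.IsAtomic.rel _ _).isQF
  let lit : I → ℒ.Formula (Fin k) := fun i => if (at' i).Realize e then at' i else ∼(at' i)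
  have hlit (M : Type) [ℒ.Structure M] (e' : Fin k → M) :
      (Formula.iInf lit).Realize e' ↔ ∀ i, (at' i).Realize e' ↔ (at' i).Realize e := by
    rw [Formula.realize_iInf]
    refine forall_congr' fun i => ?_
    by_cases h : (at' i).Realize e <;> simp [lit, h, Formula.realize_not]
  refine ⟨Formula.iInf lit, isQF_iInf fun i => ?_, (hlit W e).2 fun i => Iff.rfl,
    fun M _ e' he' => ⟨fun f x y h => ?_, fun R x => ?_⟩⟩
  · by_cases h : (at' i).Realize e
    · simpa only [lit, if_pos h] using hat i
    · simpa only [lit, if_neg h] using (hat i).not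
  · simpa [at', Function.comp_def] using ((hlit M e').1 he' (Sum.inl ⟨⟨_, f⟩, x, y⟩)).2
      (by simpa [at', Function.comp_def] using h)
  · simpa [at', Function.comp_def] using (hlit M e').1 he' (Sum.inr ⟨⟨_, R⟩, x⟩)

end QuantifierFree

/-- The truth of a quantifier-free formula at a finite tuple is determined by the `L`-type
and the `L'`-diagram of a finite tuple extending it. -/
theorem exists_local_diagram [Finite (Σ i, L'.Functions i)] [Finite (Σ i, L'.Relations i)]
    {W : Type} [L.Structure W] [L'.Structure W] {α : Type} [Finite α]
    {ψ : (L.sum L').Formula α} (hψ : ψ.IsQF) (v : α → W) :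
    ∃ (k : ℕ) (e : Fin k → W) (t : α → Fin k) (δ : L'.Formula (Fin k)), e ∘ t = v ∧ δ.IsQF ∧
      δ.Realize e ∧ ∀ (M : Type) [L.Structure M] [L'.Structure M] [Nonempty M] (e' : Fin k → M),
        SameType L e e' → δ.Realize e' → (ψ.Realize (e' ∘ t) ↔ ψ.Realize v) := by
  classical
  obtain ⟨A, hA, hloc⟩ := exists_finite_realize_qf hψ v default
  have : Finite ↥(A ∪ Set.range v) := (hA.union (Set.finite_range v)).to_subtype
  obtain ⟨k, ⟨ε⟩⟩ := Finite.exists_equiv_fin ↥(A ∪ Set.range v)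
  let e : Fin k → W := fun i => ε.symm i
  obtain ⟨δ, hδ, hδe, hδ'⟩ := exists_diagram_formula (ℒ := L') e
  refine ⟨k, e, fun a => ε ⟨v a, Or.inr ⟨a, rfl⟩⟩, δ, by ext; simp [e], hδ, hδe,
    fun M _ _ _ e' hst he' => ?_⟩
  obtain ⟨hf, hR⟩ := hδ' M e' he'
  let h : W → M := fun w => if hw : w ∈ A ∪ Set.range v then e' (ε ⟨w, hw⟩) else
    Classical.arbitrary M
  have hhe (i) : h (e i) = e' i := (dif_pos (ε.symm i).2).trans (by simp [e])
  have hex : ∀ w ∈ A ∪ Set.range v, ∃ i, e i = w := fun w hw => ⟨ε ⟨w, hw⟩, by simp [e]⟩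
  have hiso : PartialIsoOn (L.sum L') (A ∪ Set.range v) h := by
    refine ⟨fun w hw w' hw' heq => ?_, fun {n} f x hx hfx => ?_, fun {n} R x hx => ?_⟩
    · obtain ⟨i, rfl⟩ := hex w hw
      obtain ⟨j, rfl⟩ := hex w' hw'
      rw [hhe, hhe] at heq
      exact (hst.eq_iff i j).2 heq
    · choose x' hx' using fun i => hex _ (hx i)
      obtain rfl : e ∘ x' = x := funext hx'
      obtain ⟨y, hy⟩ := hex _ hfx
      rw [← hy, ← Function.comp_assoc, show h ∘ e = e' from funext hhe, hhe]
      rcases f with f | f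
      · have := hst ((Term.func f fun j => Term.var (x' j)).equal (Term.var y))
        simp only [Formula.realize_equal, Term.realize_func, Term.realize_var] at this
        exact (this.1 hy.symm).symm
      · exact (hf f x' y hy.symm).symm
    · choose x' hx' using fun i => hex _ (hx i)
      obtain rfl : e ∘ x' = x := funext hx'
      rw [← Function.comp_assoc, show h ∘ e = e' from funext hhe]
      rcases R with R | R
      · have := hst (R.formula fun j => Term.var (x' j))
        simp only [Formula.realize_rel, Term.realize_var] at this
        exact this.symm
      · exact hR R x'
  have := hloc M h (hiso.mono Set.subset_union_left)
  rw [Subsingleton.elim (h ∘ (default : Fin 0 → W)) default] at this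
  refine Iff.trans (iff_of_eq (congrArg _ (funext fun a => ?_))) this
  simp [h]

section Expansions

/-- Satisfaction in `(N, σ)` of formulas with an arbitrary type of free variables. -/
def Expansions.Sat (σ : Expansions L L' N) {α : Type} (φ : (L.sum L').Formula α)
    (v : α → N) : Prop :=
  letI := σ.str0
  φ.Realize v

namespace Expansions

variable (σ : Expansions L L' N) {α β : Type}

theorem sat_relabel (φ : (L.sum L').Formula α) (g : α → β) (v : β → N) :
    σ.Sat (φ.relabel g) v ↔ σ.Sat φ (v ∘ g) :=
  letI := σ.str0
  Formula.realize_relabel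

theorem sat_inf (φ ψ : (L.sum L').Formula α) (v : α → N) :
    σ.Sat (φ ⊓ ψ) v ↔ σ.Sat φ v ∧ σ.Sat ψ v :=
  letI := σ.str0
  Formula.realize_inf

theorem sat_sumInl (φ : L.Formula α) (v : α → N) :
    σ.Sat (LHom.sumInl.onFormula φ) v ↔ φ.Realize v :=
  letI := σ.str
  LHom.realize_onFormula (LHom.sumInl : L →ᴸ L.sum L') φ (M := N)

theorem sat_sumInr (φ : L'.Formula α) (v : α → N) :
    σ.Sat (LHom.sumInr.onFormula φ) v ↔ @Formula.Realize L' N σ.str _ φ v :=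
  letI := σ.str
  LHom.realize_onFormula (LHom.sumInr : L' →ᴸ L.sum L') φ (M := N)

end Expansions

theorem isOpen_sat {α : Type} [Finite α] {φ : (L.sum L').Formula α} (hφ : φ.IsQF) (v : α → N) :
    IsOpen {σ : Expansions L L' N | σ.Sat φ v} := by
  obtain ⟨n, ⟨ε⟩⟩ := Finite.exists_equiv_fin α
  refine TopologicalSpace.isOpen_generateFrom_of_mem
    ⟨n, φ.relabel ε, v ∘ ε.symm, isQF_relabel hφ _, ?_⟩
  ext σ
  refine Iff.trans ?_ (σ.sat_relabel φ ε (v ∘ ε.symm)).symm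
  rw [Function.comp_assoc, ε.symm_comp_self]
  rfl

theorem exists_sat_subset_of_isOpen {O : Set (Expansions L L' N)} (hO : IsOpen O)
    {σ : Expansions L L' N} (hσ : σ ∈ O) :
    ∃ (n : ℕ) (φ : (L.sum L').Formula (Fin n)) (c : Fin n → N), φ.IsQF ∧ σ.Sat φ c ∧
      ∀ τ : Expansions L L' N, τ.Sat φ c → τ ∈ O := by
  induction hO with
  | basic s hs =>
    obtain ⟨n, φ, c, hφ, rfl⟩ := hs
    exact ⟨n, φ, c, hφ, hσ, fun τ h => h⟩
  | univ => exact ⟨0, ⊤, Fin.elim0, .top, letI := σ.str0; Formula.realize_top.2 trivial,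
      fun _ _ => trivial⟩
  | inter s t _ _ ihs iht =>
    obtain ⟨n, φ, c, hφ, h₁, h₂⟩ := ihs hσ.1
    obtain ⟨m, ψ, d, hψ, h₃, h₄⟩ := iht hσ.2
    have key (τ : Expansions L L' N) :
        τ.Sat (φ.relabel (Fin.castAdd m) ⊓ ψ.relabel (Fin.natAdd n)) (Fin.append c d) ↔
          τ.Sat φ c ∧ τ.Sat ψ d := by
      rw [Expansions.sat_inf, Expansions.sat_relabel, Expansions.sat_relabel]
      refine and_congr (iff_of_eq (congrArg _ ?_)) (iff_of_eq (congrArg _ ?_)) <;>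
      · ext
        simp
    exact ⟨n + m, _, Fin.append c d, (isQF_relabel hφ _).inf (isQF_relabel hψ _),
      (key σ).2 ⟨h₁, h₃⟩, fun τ hτ => ⟨h₂ τ ((key τ).1 hτ).1, h₄ τ ((key τ).1 hτ).2⟩⟩
  | sUnion S _ ih =>
    obtain ⟨s, hs, hσs⟩ := hσ
    obtain ⟨n, φ, c, hφ, h₁, h₂⟩ := ih s hs hσs
    exact ⟨n, φ, c, hφ, h₁, fun τ hτ => ⟨s, hs, h₂ τ hτ⟩⟩

/-- The model of `T₀` given by an expansion. -/
def Expansions.toModelOf [Nonempty N] {T₀ : (L.sum L').Theory} (σ : Expansions L L' N)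
    (h : σ.ModelsTh T₀) : ModelOf T₀ :=
  letI := σ.str
  ⟨N, h⟩

theorem SameType.exists_expansion [Countable N] [Nonempty N] {T : L.Theory}
    {T₀ : (L.sum L').Theory} [Finite (Σ i, L'.Functions i)] (hNT : N ⊨ T) (hqe : HasQE L T)
    (hsat : IsSaturated L N) (hTT₀ : (LHom.sumInl : L →ᴸ L.sum L').onTheory T ⊆ T₀)
    (huniv : UniversalTheoryModulo L L' T T₀) (W : ModelOf T₀) {ι : Type} [Finite ι]
    {a : ι → N} {u : ι → W} (h : SameType L a u) :
    ∃ σ : Expansions L L' N, σ.ModelsTh T₀ ∧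
      ∀ φ : (L.sum L').Formula ι, φ.IsQF → (σ.Sat φ a ↔ φ.Realize u) := by
  obtain ⟨V, i, -, hV⟩ := exists_extension_ec_saturated hqe hTT₀ huniv W
  obtain ⟨i', hi'⟩ := hqe.exists_elementary (models_left hTT₀ W.models)
    (models_left hTT₀ V.models) (reductEmbedding i)
  obtain ⟨g, hg, hcl⟩ := (h.trans (sameType_elementary i' u)).exists_elementary_closed hsat hV
    (J := Σ n, L'.Functions n) (fun f => f.1) fun f x => Structure.funMap f.2 x
  replace hg : g ∘ a = i ∘ u := by rw [hg, hi']; rfl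
  choose F hF using hcl
  let S : L'.Structure N := ⟨fun {n} f x => F ⟨n, f⟩ x, fun R x => Structure.RelMap R (g ∘ x)⟩
  let e : N ↪[L.sum L'] V := by
    refine ⟨⟨g, g.injective⟩, fun {n} f x => ?_, fun {n} R x => ?_⟩
    · rcases f with f | f
      · exact g.map_fun f x
      · exact hF ⟨n, f⟩ x
    · rcases R with R | R
      · exact g.map_rel R x
      · exact Iff.rfl
  refine ⟨S, huniv.models_of_embedding hTT₀ hNT V.models e, fun φ hφ => ?_⟩
  rw [← realize_qf_embedding i hφ u, ← hg]
  exact (realize_qf_embedding e hφ a).symm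

section Conjugation

variable (g : N ≃[L] N) (σ : Expansions L L' N)

/-- An automorphism `g` of `N` is an isomorphism from `(N, σ)` to its conjugate by `g`. -/
def conjEquiv : @Language.Equiv (L.sum L') N N σ.str0 (conjExp g σ).str0 :=
  @Language.Equiv.mk (L.sum L') N N σ.str0 (conjExp g σ).str0 g.toEquiv
    (fun {n} f x => by
      rcases f with f | f
      · exact g.map_fun f x
      · refine congrArg (fun y => g (σ.str.funMap f y)) (funext fun i => ?_)
        exact (g.symm_apply_apply (x i)).symm)
    (fun {n} R x => by
      rcases R with R | R
      · exact g.map_rel R x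
      · refine iff_of_eq (congrArg (fun y => σ.str.RelMap R y) (funext fun i => ?_))
        exact g.symm_apply_apply (x i))

theorem realize_equiv {ℒ : FirstOrder.Language.{0,0}} {M W α : Type} [ℒ.Structure M]
    [ℒ.Structure W] (e : M ≃[ℒ] W) (φ : ℒ.Formula α) (v : α → M) :
    φ.Realize (e ∘ v) ↔ φ.Realize v :=
  StrongHomClass.realize_formula e φ

theorem sat_conjExp {α : Type} (φ : (L.sum L').Formula α) (v : α → N) :
    (conjExp g σ).Sat φ (g ∘ v) ↔ σ.Sat φ v :=
  @realize_equiv (L.sum L') N N α σ.str0 (conjExp g σ).str0 (conjEquiv g σ) φ v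

theorem sat_conjExp_symm {α : Type} (φ : (L.sum L').Formula α) (v : α → N) :
    (conjExp g σ).Sat φ v ↔ σ.Sat φ (g.symm ∘ v) := by
  rw [← sat_conjExp g σ φ (g.symm ∘ v)]
  refine iff_of_eq (congrArg _ (funext fun i => ?_))
  exact (g.apply_symm_apply (v i)).symm

theorem modelsTh_conjExp {T₀ : (L.sum L').Theory} (h : σ.ModelsTh T₀) :
    (conjExp g σ).ModelsTh T₀ := by
  refine (@Theory.model_iff (L.sum L') N (conjExp g σ).str0 T₀).2 fun φ hφ => ?_
  have h' : σ.Sat φ default := (@Theory.model_iff (L.sum L') N σ.str0 T₀).1 h φ hφ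
  rwa [← sat_conjExp g σ, Subsingleton.elim (g ∘ (default : Empty → N)) default] at h'

theorem isSmooth_conjExp (h : σ.IsSmooth) : (conjExp g σ).IsSmooth := by
  have hsymm {k n : ℕ} (c : Fin k → N) (x : Fin n → N) :
      g.symm ∘ Sum.elim c x = Sum.elim (g.symm ∘ c) (g.symm ∘ x) := Sum.comp_elim _ _ _
  have hg {n : ℕ} (x : Fin n → N) : g.symm ∘ g ∘ x = x :=
    funext fun i => g.symm_apply_apply (x i)
  intro k n c p ψ hψ hp
  obtain ⟨x, hx, hχ⟩ := h k n (g.symm ∘ c) p ψ hψ fun s hs => by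
    obtain ⟨x, hx, hχ⟩ := hp s hs
    refine ⟨g.symm ∘ x, ?_, fun χ hχs => ?_⟩
    · rw [← hsymm]
      exact (sat_conjExp_symm g σ ψ _).1 hx
    · rw [← hsymm]
      exact (realize_equiv g.symm χ _).2 (hχ χ hχs)
  refine ⟨g ∘ x, ?_, fun χ hχp => ?_⟩
  · refine (sat_conjExp_symm g σ ψ _).2 ?_
    rw [hsymm, hg]
    exact hx
  · rw [← realize_equiv g.symm, hsymm, hg]
    exact hχ χ hχp

theorem isEC_conjExp {T₀ : (L.sum L').Theory} (h : σ.IsEC T₀) : (conjExp g σ).IsEC T₀ := by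
  rintro k n φ c hφ ⟨U, iU, iU', j, hU, x, hx⟩
  obtain ⟨y, hy⟩ := h k n φ (g.symm ∘ c) hφ ⟨U, iU, iU',
    @Language.Embedding.comp (L.sum L') N N σ.str0 (conjExp g σ).str0 U _ j
      (@Language.Equiv.toEmbedding (L.sum L') N N σ.str0 (conjExp g σ).str0 (conjEquiv g σ)),
    hU, x, by
      convert hx using 2
      exact funext fun i => congrArg j (g.apply_symm_apply (c i))⟩
  refine ⟨g ∘ y, ?_⟩
  refine (sat_conjExp_symm g σ φ _).2 ?_
  rw [Sum.comp_elim, show g.symm ∘ g ∘ y = y from funext fun i => g.symm_apply_apply (y i)]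
  exact hy

theorem conjExp_mem_YSet {T₀ : (L.sum L').Theory} (h : σ ∈ YSet L L' N T₀) :
    conjExp g σ ∈ YSet L L' N T₀ :=
  ⟨modelsTh_conjExp g σ h.1, isSmooth_conjExp g σ h.2.1, isEC_conjExp g σ h.2.2⟩

end Conjugation

end Expansions

section Comeagre

/-- The expansions satisfying `δ` at some conjugate of `d` over `c`. -/
def orbitSet {k m : ℕ} (c : Fin k → N) (δ : L'.Formula (Fin m)) (d : Fin m → N) :
    Set (Expansions L L' N) :=
  {σ | ∃ g : N ≃[L] N, g ∘ c = c ∧ σ.Sat (LHom.sumInr.onFormula δ) (g ∘ d)}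

theorem isOpen_orbitSet {k m : ℕ} (c : Fin k → N) {δ : L'.Formula (Fin m)} (hδ : δ.IsQF)
    (d : Fin m → N) : IsOpen (orbitSet (L := L) c δ d) := by
  have : orbitSet (L := L) c δ d = ⋃ (g : N ≃[L] N) (_ : g ∘ c = c),
      {σ : Expansions L L' N | σ.Sat (LHom.sumInr.onFormula δ) (g ∘ d)} := by
    ext σ
    simp [orbitSet]
  rw [this]
  exact isOpen_iUnion fun g => isOpen_iUnion fun _ => isOpen_sat (isQF_onBoundedFormula _ hδ) _

/-- `σ` is not on the boundary in `Exp(N, T₀)` of any of the sets `orbitSet c δ d`. -/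
def Expansions.Decides (σ : Expansions L L' N) (T₀ : (L.sum L').Theory) : Prop :=
  ∀ (k : ℕ) (c : Fin k → N) (m : ℕ) (δ : L'.Formula (Fin m)) (d : Fin m → N), δ.IsQF →
    σ ∈ orbitSet c δ d ∨ ∃ (n : ℕ) (θ : (L.sum L').Formula (Fin n)) (a : Fin n → N),
      θ.IsQF ∧ σ.Sat θ a ∧ ∀ τ : Expansions L L' N, τ.ModelsTh T₀ → τ.Sat θ a →
        τ ∉ orbitSet c δ d

theorem eventually_residual_decides [Countable N] [Finite (Σ i, L'.Functions i)]
    [Finite (Σ i, L'.Relations i)] (T₀ : (L.sum L').Theory) :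
    ∀ᶠ σ : ↥(ExpSet L L' N T₀) in residual _, (σ : Expansions L L' N).Decides T₀ := by
  have : Countable L'.Symbols := inferInstanceAs (Countable (_ ⊕ _))
  have hc (m : ℕ) : Countable (L'.Formula (Fin m)) := inferInstance
  simp only [Expansions.Decides]
  refine eventually_countable_forall.2 fun k => eventually_countable_forall.2 fun c =>
    eventually_countable_forall.2 fun m => eventually_countable_forall.2 fun δ =>
    eventually_countable_forall.2 fun d => eventually_countable_forall.2 fun hδ => ?_
  let O : Set ↥(ExpSet L L' N T₀) := Subtype.val ⁻¹' orbitSet c δ d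
  have hO : IsOpen O := (isOpen_orbitSet c hδ d).preimage continuous_subtype_val
  have hfr : (frontier O)ᶜ ∈ residual ↥(ExpSet L L' N T₀) := by
    refine residual_of_dense_open isClosed_frontier.isOpen_compl ?_
    rw [← interior_eq_empty_iff_dense_compl, ← frontier_compl]
    exact interior_frontier hO.isClosed_compl
  filter_upwards [hfr] with σ hσ
  by_cases h : σ ∈ O
  · exact Or.inl h
  · have hσ' : σ ∈ (closure O)ᶜ := fun h' => hσ ⟨h', by rwa [hO.interior_eq]⟩
    obtain ⟨V, hV, hV'⟩ := isOpen_induced_iff.1 (isClosed_closure (s := O)).isOpen_compl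
    obtain ⟨n, θ, a, hθ, h₁, h₂⟩ := exists_sat_subset_of_isOpen hV
      (σ := (σ : Expansions L L' N)) (by rw [← hV'] at hσ'; exact hσ')
    refine Or.inr ⟨n, θ, a, hθ, h₁, fun τ hτ hτθ hτO => ?_⟩
    have : (⟨τ, hτ⟩ : ↥(ExpSet L L' N T₀)) ∈ (closure O)ᶜ := by
      rw [← hV']
      exact h₂ τ hτθ
    exact this (subset_closure hτO)

section Solve

variable [Countable N] [Nonempty N] {T : L.Theory}
  {T₀ : (L.sum L').Theory} [Finite (Σ i, L'.Functions i)] [Finite (Σ i, L'.Relations i)]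
  {σ : Expansions L L' N}

theorem Expansions.Decides.exists_solution
    (hNT : N ⊨ T) (hqe : HasQE L T)
    (hsat : IsSaturated L N) (hTT₀ : (LHom.sumInl : L →ᴸ L.sum L').onTheory T ⊆ T₀)
    (huniv : UniversalTheoryModulo L L' T T₀) (hd : σ.Decides T₀) (W : ModelOf T₀) (j : N → W)
    (hj : ∃ e : @Language.Embedding (L.sum L') N W σ.str0 _, ∀ x, e x = j x)
    {k n : ℕ} (c : Fin k → N) (p : Set (L.Formula (Fin k ⊕ Fin n)))
    {ψ : (L.sum L').Formula (Fin k ⊕ Fin n)} (hψ : ψ.IsQF) (x : Fin n → W)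
    (hx : ψ.Realize (Sum.elim (j ∘ c) x)) (hp : ∀ χ ∈ p, χ.Realize (Sum.elim (j ∘ c) x)) :
    ∃ y : Fin n → N, σ.Sat ψ (Sum.elim c y) ∧ ∀ χ ∈ p, χ.Realize (Sum.elim c y) := by
  obtain ⟨i, hi⟩ := hj
  obtain ⟨i', hi'⟩ : ∃ i' : N ↪ₑ[L] W, ⇑i' = j := by
    obtain ⟨i', hi'⟩ := hqe.exists_elementary hNT (models_left hTT₀ W.models)
      (letI := σ.str; reductEmbedding i)
    exact ⟨i', hi'.trans (funext hi)⟩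
  subst hi'
  obtain ⟨m, e, t, δ, het, hδ, hδe, hloc⟩ := exists_local_diagram hψ (Sum.elim (i' ∘ c) x)
  obtain ⟨e₁, he₁⟩ := (sameType_elementary i' c).symm.exists_extend hsat e
  suffices h : ∃ e₂ : Fin m → N, SameType L (Sum.elim (i' ∘ c) e) (Sum.elim c e₂) ∧
      σ.Sat (LHom.sumInr.onFormula δ) e₂ by
    obtain ⟨e₂, he₂, hsat₂⟩ := h
    have hst := he₂.comp (Sum.inr : Fin m → Fin k ⊕ Fin m)
    have hall : SameType L (Sum.elim (i' ∘ c) x) (Sum.elim c (e₂ ∘ t ∘ Sum.inr)) := by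
      convert he₂.comp (Sum.elim Sum.inl fun q => Sum.inr (t (Sum.inr q)) :
        Fin k ⊕ Fin n → Fin k ⊕ Fin m) using 1
      · ext (q | q)
        · rfl
        · exact (congrFun het (Sum.inr q)).symm
      · ext (q | q) <;> rfl
    have het₂ : e₂ ∘ t = Sum.elim c (e₂ ∘ t ∘ Sum.inr) := by
      ext (q | q)
      · exact (he₂.eq_iff (Sum.inr (t (Sum.inl q))) (Sum.inl q)).1 (congrFun het (Sum.inl q))
      · rfl
    refine ⟨e₂ ∘ t ∘ Sum.inr, ?_, fun χ hχ => (hall χ).1 (hp χ hχ)⟩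
    rw [← het₂]
    let _ := σ.str
    exact (hloc N e₂ hst ((σ.sat_sumInr δ e₂).1 hsat₂)).2 hx
  rcases hd k c m δ e₁ hδ with ⟨g, hgc, hg⟩ | ⟨l, θ, a, hθ, hσθ, hav⟩
  · refine ⟨g ∘ e₁, fun φ => (he₁ φ).trans ?_, hg⟩
    rw [← realize_equiv g, Sum.comp_elim, hgc]
  · exfalso
    have hθW : θ.Realize (i' ∘ a) := by
      have := (@realize_qf_embedding (L.sum L') N W _ σ.str0 _ i θ hθ a).2 hσθ
      convert this using 2
      exact funext fun q => (hi _).symm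
    obtain ⟨e₂, he₂⟩ := (sameType_elementary i' (Sum.elim c a)).symm.exists_extend hsat e
    obtain ⟨τ, hτ, hτs⟩ := he₂.symm.exists_expansion hNT hqe hsat hTT₀ huniv
    have he₁₂ : SameType L (Sum.elim c e₁) (Sum.elim c e₂) := by
      refine he₁.symm.trans ?_
      convert he₂.comp (Sum.elim (Sum.inl ∘ Sum.inl) Sum.inr) using 1 <;>
      · ext (q | q) <;> rfl
    obtain ⟨g, hg⟩ := he₁₂.exists_equiv hsat
    rw [Sum.comp_elim] at hg
    refine hav τ hτ ?_ ⟨g, funext fun q => congrFun hg (Sum.inl q), ?_⟩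
    · refine (τ.sat_relabel θ (Sum.inl ∘ Sum.inr) (Sum.elim (Sum.elim c a) e₂)).1
        ((hτs _ (isQF_relabel hθ _)).2 (Formula.realize_relabel.2 ?_))
      exact hθW
    · rw [show g ∘ e₁ = e₂ from funext fun q => congrFun hg (Sum.inr q)]
      refine (τ.sat_relabel _ Sum.inr (Sum.elim (Sum.elim c a) e₂)).1
        ((hτs _ (isQF_relabel (isQF_onBoundedFormula _ hδ) _)).2 (Formula.realize_relabel.2 ?_))
      exact (LHom.realize_onFormula (LHom.sumInr : L' →ᴸ L.sum L') δ).2 hδe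

theorem Expansions.Decides.isEC
    (hNT : N ⊨ T) (hqe : HasQE L T)
    (hsat : IsSaturated L N) (hTT₀ : (LHom.sumInl : L →ᴸ L.sum L').onTheory T ⊆ T₀)
    (huniv : UniversalTheoryModulo L L' T T₀) (hd : σ.Decides T₀) : σ.IsEC T₀ := by
  rintro k n φ c hφ ⟨U, iU, iU', j, hU, x, hx⟩
  have : Nonempty U := Nonempty.map j inferInstance
  obtain ⟨y, hy, -⟩ := hd.exists_solution hNT hqe hsat hTT₀ huniv ⟨U, hU⟩ j ⟨j, fun _ => rfl⟩
    c ∅ hφ x hx (by simp)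
  exact ⟨y, hy⟩

theorem Expansions.Decides.isSmooth
    (hNT : N ⊨ T) (hqe : HasQE L T)
    (hsat : IsSaturated L N) (hTT₀ : (LHom.sumInl : L →ᴸ L.sum L').onTheory T ⊆ T₀)
    (huniv : UniversalTheoryModulo L L' T T₀) (hd : σ.Decides T₀) (hσ : σ.ModelsTh T₀) :
    σ.IsSmooth := by
  classical
  intro k n c p ψ hψ hp
  let _ := σ.str
  let I := {φ : (L.sum L').Formula N // φ.Realize (id : N → N)} ⊕ p ⊕ Unit
  let q : Fin k ⊕ Fin n → N ⊕ Fin n := Sum.map c id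
  let Φ : I → (L.sum L').Formula (N ⊕ Fin n) := Sum.elim (fun φ => φ.1.relabel Sum.inl)
    (Sum.elim (fun χ => (LHom.sumInl.onFormula χ.1).relabel q) fun _ => ψ.relabel q)
  have hq {M : Type} (f : N → M) (y : Fin n → M) : Sum.elim f y ∘ q = Sum.elim (f ∘ c) y := by
    ext (i | i) <;> rfl
  obtain ⟨W, f, hf⟩ := exists_realize_of_finset T₀ Φ fun s => by
    obtain ⟨x, hx, hχ⟩ := hp (s.biUnion (Sum.elim (fun _ => ∅) (Sum.elim (fun χ => {χ.1}) fun _ => ∅)))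
      (by
        intro χ hχ
        simp only [Finset.coe_biUnion, Set.mem_iUnion] at hχ
        obtain ⟨i, hi, hχ⟩ := hχ
        rcases i with i | i | i
        · simp at hχ
        · simp only [Sum.elim_inr, Sum.elim_inl, Finset.coe_singleton, Set.mem_singleton_iff] at hχ
          exact hχ ▸ i.2
        · simp at hχ)
    refine ⟨σ.toModelOf hσ, Sum.elim id x, fun i hi => ?_⟩
    rcases i with i | i | i
    · exact Formula.realize_relabel.2 i.2
    · refine (σ.sat_relabel _ q (Sum.elim id x)).2 ?_
      rw [hq]
      refine (σ.sat_sumInl i.1 _).2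
        (hχ i.1 (Finset.mem_biUnion.2 ⟨_, hi, ?_⟩))
      simp
    · refine (σ.sat_relabel _ q (Sum.elim id x)).2 ?_
      rw [hq]
      exact hx
  obtain ⟨e, he⟩ := exists_embedding_of_forall_qf (ℒ := L.sum L') (f ∘ Sum.inl : N → W)
    fun φ _ hφ => Formula.realize_relabel.1 (hf (Sum.inl ⟨φ, hφ⟩))
  have hfe : f = Sum.elim (f ∘ Sum.inl) (f ∘ Sum.inr) := (Sum.elim_comp_inl_inr f).symm
  refine hd.exists_solution hNT hqe hsat hTT₀ huniv W (f ∘ Sum.inl) ⟨e, congrFun he⟩ c p hψ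
    (f ∘ Sum.inr) ?_ fun χ hχ => ?_
  · have := Formula.realize_relabel.1 (hf (Sum.inr (Sum.inr ())))
    rwa [hfe, hq] at this
  · have := Formula.realize_relabel.1 (hf (Sum.inr (Sum.inl ⟨χ, hχ⟩)))
    rw [hfe, hq] at this
    exact (LHom.realize_onFormula (LHom.sumInl : L →ᴸ L.sum L') χ).1 this

variable (N) in
theorem eventually_residual_mem_YSet
    (hNT : N ⊨ T) (hqe : HasQE L T)
    (hsat : IsSaturated L N) (hTT₀ : (LHom.sumInl : L →ᴸ L.sum L').onTheory T ⊆ T₀)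
    (huniv : UniversalTheoryModulo L L' T T₀) :
    ∀ᶠ σ : ↥(ExpSet L L' N T₀) in residual _, (σ : Expansions L L' N) ∈ YSet L L' N T₀ := by
  filter_upwards [eventually_residual_decides T₀] with σ hd
  exact ⟨σ.2, hd.isSmooth hNT hqe hsat hTT₀ huniv σ.2, hd.isEC hNT hqe hsat hTT₀ huniv⟩

end Solve

end Comeagre

section Existential

theorem isExistential_exs {ℒ : FirstOrder.Language.{0,0}} {α : Type} {n : ℕ}
    {φ : ℒ.BoundedFormula α n} (h : φ.IsExistential) : BoundedFormula.IsExistential φ.exs := by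
  induction n with
  | zero => exact h
  | succ n ih => exact ih h.ex

theorem isExistential_iExs {ℒ : FirstOrder.Language.{0,0}} {α β : Type} [Finite β]
    {φ : ℒ.Formula (α ⊕ β)} (h : φ.IsQF) : BoundedFormula.IsExistential (φ.iExs β) :=
  isExistential_exs (BoundedFormula.IsQF.relabel h _).isExistential

theorem HasQE.exists_isQF {T : L.Theory} (hqe : HasQE L T) {α : Type} [Finite α]
    (φ : L.Formula α) : ∃ ψ : L.Formula α, ψ.IsQF ∧
      ∀ (M : Type) [L.Structure M] [Nonempty M], M ⊨ T →
        ∀ v : α → M, ψ.Realize v ↔ φ.Realize v := by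
  obtain ⟨n, ⟨ε⟩⟩ := Finite.exists_equiv_fin α
  obtain ⟨ψ, hψ, h⟩ := hqe n (φ.relabel ε)
  refine ⟨ψ.relabel ε.symm, isQF_relabel hψ _, fun M _ _ hM v => ?_⟩
  have := h.realize_formula M (v := v ∘ ε.symm)
  rw [Formula.realize_iff, Formula.realize_relabel, Function.comp_assoc, ε.symm_comp_self,
    Function.comp_id] at this
  rw [Formula.realize_relabel, this]

/-- Modulo `T`, the solvability of finitely many `L`-formulas together with a quantifier-free
formula is expressed by an existential formula. -/
theorem HasQE.exists_isExistential {T : L.Theory} (hqe : HasQE L T) {α β : Type} [Finite α]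
    [Finite β] (s : Finset (L.Formula (α ⊕ β))) {ψ : (L.sum L').Formula (α ⊕ β)} (hψ : ψ.IsQF) :
    ∃ θ : (L.sum L').Formula α, BoundedFormula.IsExistential θ ∧
      ∀ (M : Type) [L.Structure M] [L'.Structure M] [Nonempty M], M ⊨ T → ∀ v : α → M,
        θ.Realize v ↔
          ∃ y : β → M, (∀ χ ∈ s, χ.Realize (Sum.elim v y)) ∧ ψ.Realize (Sum.elim v y) := by
  obtain ⟨χ, hχ, h⟩ := hqe.exists_isQF (Formula.iInf fun i : s => i.1)
  refine ⟨(LHom.sumInl.onFormula χ ⊓ ψ).iExs β,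
    isExistential_iExs ((isQF_onBoundedFormula _ hχ).inf hψ), fun M _ _ _ hM v => ?_⟩
  rw [Formula.realize_iExs]
  refine exists_congr fun y => ?_
  rw [Formula.realize_inf, LHom.realize_onFormula (LHom.sumInl : L →ᴸ L.sum L'), h M hM,
    Formula.realize_iInf, Subtype.forall]

end Existential

section Isolation

variable {T : L.Theory} {T₀ : (L.sum L').Theory}

theorem EQF.realizeAt_of_diag1_eq [Nonempty N] (hNT : N ⊨ T) (hqe : HasQE L T)
    {σ τ : Expansions L L' N} (hτ : τ.IsSmooth) {n : ℕ} {b : Fin n → N}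
    (h : diag1 σ b = diag1 τ b) {π : EQF L L' n} (hπ : π.RealizeAt σ b) : π.RealizeAt τ b := by
  obtain ⟨y, hy, hyφ⟩ := hτ n π.m b π.p π.φ π.qf fun s hs => by
    obtain ⟨θ, hθ, hiff⟩ := hqe.exists_isExistential s π.qf
    have key (ρ : Expansions L L' N) : ρ.Realizes θ b ↔ ∃ y : Fin π.m → N,
        (∀ χ ∈ s, χ.Realize (Sum.elim b y)) ∧ ρ.Sat π.φ (Sum.elim b y) := by
      let _ := ρ.str
      exact hiff N hNT b
    have hmem : θ ∈ diag1 σ b := by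
      obtain ⟨y, hy, hyφ⟩ := hπ
      exact ⟨(key σ).2 ⟨y, fun χ hχ => hy χ (hs hχ), hyφ⟩, Or.inr hθ⟩
    rw [h] at hmem
    obtain ⟨y, hy, hyφ⟩ := (key τ).1 hmem.1
    exact ⟨y, hyφ, hy⟩
  exact ⟨y, hyφ, hy⟩

/-- The expansions in `Y` realizing all of `Γ` at `b` have the same 1-diagram at `b`. -/
def IsolatedBy (T₀ : (L.sum L').Theory) {n : ℕ} (b : Fin n → N) (Γ : Set (EQF L L' n)) : Prop :=
  ∀ σ ∈ YSet L L' N T₀, ∀ τ ∈ YSet L L' N T₀, (∀ π ∈ Γ, π.RealizeAt σ b) →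
    (∀ π ∈ Γ, π.RealizeAt τ b) → diag1 σ b = diag1 τ b

theorem mem_dBasic_iff [Nonempty N] (hNT : N ⊨ T) (hqe : HasQE L T)
    {σ : Expansions L L' N} (hσ : σ ∈ YSet L L' N T₀) {n : ℕ} {b : Fin n → N}
    {π : EQF L L' n} : diag1 σ b ∈ DBasic L L' N T₀ b π ↔ π.RealizeAt σ b := by
  refine ⟨?_, fun h => ⟨σ, hσ, rfl, h⟩⟩
  rintro ⟨τ, -, h, hπ⟩
  exact EQF.realizeAt_of_diag1_eq hNT hqe hσ.2.1 h.symm hπ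

theorem image_val_eq_dBasic_iff {n : ℕ} {b : Fin n → N} {π : EQF L L' n}
    {s : Set ↥(DSet L L' N T₀ b)} :
    Subtype.val '' s = DBasic L L' N T₀ b π ↔ s = Subtype.val ⁻¹' DBasic L L' N T₀ b π := by
  refine ⟨fun h => by rw [← h, Set.preimage_image_eq _ Subtype.val_injective], ?_⟩
  rintro rfl
  refine Set.image_preimage_eq_of_subset ?_
  rintro d ⟨σ, hσ, h, -⟩
  exact ⟨⟨d, σ, hσ, h⟩, rfl⟩

theorem exists_finite_of_isOpen_dTop {n : ℕ} {b : Fin n → N} {O : Set ↥(DSet L L' N T₀ b)}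
    (hO : @IsOpen _ (DTop L L' N T₀ b) O) {d : ↥(DSet L L' N T₀ b)} (hd : d ∈ O) :
    ∃ Γ : Set (EQF L L' n), Γ.Finite ∧ (∀ π ∈ Γ, (d : Set _) ∈ DBasic L L' N T₀ b π) ∧
      ∀ d' : ↥(DSet L L' N T₀ b), (∀ π ∈ Γ, (d' : Set _) ∈ DBasic L L' N T₀ b π) → d' ∈ O := by
  induction hO with
  | basic s hs =>
    obtain ⟨π, hs⟩ := hs
    obtain rfl := image_val_eq_dBasic_iff.1 hs
    exact ⟨{π}, Set.finite_singleton π, fun _ h => h ▸ hd, fun d' h => h π rfl⟩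
  | univ => exact ⟨∅, Set.finite_empty, by simp, fun _ _ => trivial⟩
  | inter s t _ _ ihs iht =>
    obtain ⟨Γ, hf, h₁, h₂⟩ := ihs hd.1
    obtain ⟨Δ, hf', h₃, h₄⟩ := iht hd.2
    exact ⟨Γ ∪ Δ, hf.union hf', fun π hπ => hπ.elim (h₁ π) (h₃ π), fun d' h =>
      ⟨h₂ d' fun π hπ => h π (Or.inl hπ), h₄ d' fun π hπ => h π (Or.inr hπ)⟩⟩
  | sUnion S _ ih =>
    obtain ⟨s, hs, hds⟩ := hd
    obtain ⟨Γ, hf, h₁, h₂⟩ := ih s hs hds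
    exact ⟨Γ, hf, h₁, fun d' h => ⟨s, hs, h₂ d' h⟩⟩

theorem isEAtomic_iff [Nonempty N] (hNT : N ⊨ T) (hqe : HasQE L T) {σ : Expansions L L' N} :
    IsEAtomic L L' N T₀ σ ↔ σ ∈ YSet L L' N T₀ ∧ ∀ (n : ℕ) (b : Fin n → N),
      ∃ Γ : Set (EQF L L' n), Γ.Finite ∧ IsolatedBy T₀ b Γ ∧ ∀ π ∈ Γ, π.RealizeAt σ b := by
  refine and_congr_right fun hσ => forall_congr' fun n => forall_congr' fun b => ⟨fun h => ?_, ?_⟩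
  · obtain ⟨Γ, hf, h₁, h₂⟩ := exists_finite_of_isOpen_dTop h
      (d := ⟨diag1 σ b, σ, hσ, rfl⟩) rfl
    have key : ∀ τ ∈ YSet L L' N T₀, (∀ π ∈ Γ, π.RealizeAt τ b) → diag1 τ b = diag1 σ b :=
      fun τ hτ h => h₂ ⟨diag1 τ b, τ, hτ, rfl⟩ fun π hπ => ⟨τ, hτ, rfl, h π hπ⟩
    exact ⟨Γ, hf, fun τ hτ τ' hτ' h h' => (key τ hτ h).trans (key τ' hτ' h').symm,
      fun π hπ => (mem_dBasic_iff hNT hqe hσ).1 (h₁ π hπ)⟩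
  · rintro ⟨Γ, hf, h₁, h₂⟩
    let _ := DTop L L' N T₀ b
    have : {d : ↥(DSet L L' N T₀ b) | (d : Set _) = diag1 σ b} =
        ⋂ π ∈ Γ, {d : ↥(DSet L L' N T₀ b) | (d : Set _) ∈ DBasic L L' N T₀ b π} := by
      ext ⟨d, τ, hτ, rfl⟩
      simp only [Set.mem_ofPred_eq, Set.mem_iInter, mem_dBasic_iff hNT hqe hτ]
      exact ⟨fun h π hπ => EQF.realizeAt_of_diag1_eq hNT hqe hτ.2.1 h.symm (h₂ π hπ),
        fun h => h₁ τ hτ σ hσ h h₂⟩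
    rw [this]
    exact hf.isOpen_biInter fun π _ => TopologicalSpace.isOpen_generateFrom_of_mem
      ⟨π, image_val_eq_dBasic_iff.2 rfl⟩

theorem diag1_conjExp (g : N ≃[L] N) (σ : Expansions L L' N) {n : ℕ} (b : Fin n → N) :
    diag1 (conjExp g σ) (g ∘ b) = diag1 σ b := by
  ext φ
  exact and_congr_left fun _ => sat_conjExp g σ φ b

theorem EQF.realizeAt_conjExp (g : N ≃[L] N) (σ : Expansions L L' N) {n : ℕ} (b : Fin n → N)
    (π : EQF L L' n) : π.RealizeAt (conjExp g σ) (g ∘ b) ↔ π.RealizeAt σ b := by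
  refine Iff.symm ((Equiv.arrowCongr (Equiv.refl _) g.toEquiv).exists_congr fun y => ?_)
  have hy : Sum.elim (g ∘ b) (g ∘ y) = g ∘ Sum.elim b y := (Sum.comp_elim _ _ _).symm
  refine and_congr (forall₂_congr fun χ _ => ?_) ?_
  · refine (realize_equiv g χ _).symm.trans ?_
    rw [← hy]
    rfl
  · refine (sat_conjExp g σ π.φ _).symm.trans ?_
    rw [← hy]
    rfl

theorem IsolatedBy.conj {n : ℕ} {b : Fin n → N} {Γ : Set (EQF L L' n)}
    (h : IsolatedBy T₀ b Γ) (g : N ≃[L] N) : IsolatedBy T₀ (g ∘ b) Γ := by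
  intro σ hσ τ hτ hΓσ hΓτ
  have hg : g.symm ∘ g ∘ b = b := funext fun i => g.symm_apply_apply (b i)
  have := h _ (conjExp_mem_YSet g.symm σ hσ) _ (conjExp_mem_YSet g.symm τ hτ)
    (fun π hπ => by
      have := (EQF.realizeAt_conjExp g.symm σ (g ∘ b) π).2 (hΓσ π hπ)
      rwa [hg] at this)
    (fun π hπ => by
      have := (EQF.realizeAt_conjExp g.symm τ (g ∘ b) π).2 (hΓτ π hπ)
      rwa [hg] at this)
  have hdiag (ρ : Expansions L L' N) : diag1 (conjExp g.symm ρ) b = diag1 ρ (g ∘ b) := by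
    rw [← diag1_conjExp g.symm ρ, hg]
  rwa [hdiag, hdiag] at this

theorem isEAtomic_conjExp [Nonempty N] (hNT : N ⊨ T) (hqe : HasQE L T) (g : N ≃[L] N)
    {σ : Expansions L L' N} (h : IsEAtomic L L' N T₀ σ) : IsEAtomic L L' N T₀ (conjExp g σ) := by
  rw [isEAtomic_iff hNT hqe] at h ⊢
  refine ⟨conjExp_mem_YSet g σ h.1, fun n b => ?_⟩
  obtain ⟨Γ, hf, h₁, h₂⟩ := h.2 n (g.symm ∘ b)
  have hg : g ∘ g.symm ∘ b = b := funext fun i => g.apply_symm_apply (b i)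
  refine ⟨Γ, hf, ?_, fun π hπ => ?_⟩
  · rw [← hg]
    exact h₁.conj g
  · rw [← hg]
    exact (EQF.realizeAt_conjExp g σ _ π).2 (h₂ π hπ)

end Isolation

section Density

variable {T : L.Theory} {T₀ : (L.sum L').Theory}

theorem Expansions.IsEC.isECModel {σ : Expansions L L' N} (h : σ.IsEC T₀) (hσ : σ.ModelsTh T₀) :
    @IsECModel L L' T₀ N _ σ.str :=
  ⟨hσ, h⟩

theorem exists_sat_conjExp [Countable N] [Nonempty N] (hNT : N ⊨ T) (hqe : HasQE L T)
    (hsat : IsSaturated L N) (hTT₀ : (LHom.sumInl : L →ᴸ L.sum L').onTheory T ⊆ T₀)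
    (huniv : UniversalTheoryModulo L L' T T₀) (hsame : SameExistentialTheory L L' T₀)
    {α : Expansions L L' N} (hα : α ∈ YSet L L' N T₀) {σ : Expansions L L' N}
    (hσ : σ.ModelsTh T₀) {n : ℕ} {ψ : (L.sum L').Formula (Fin n)} (hψ : ψ.IsQF) {c : Fin n → N}
    (hc : σ.Sat ψ c) : ∃ g : N ≃[L] N, (conjExp g α).Sat ψ c := by
  classical
  obtain ⟨V, i, hV, -⟩ := exists_extension_ec_saturated hqe hTT₀ huniv (σ.toModelOf hσ)
  obtain ⟨i', hi'⟩ : ∃ i' : N ↪ₑ[L] V, ⇑i' = i :=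
    hqe.exists_elementary hNT (models_left hTT₀ V.models) (let _ := σ.str; reductEmbedding i)
  obtain ⟨x, hx, hxp⟩ := hα.2.1 0 n Fin.elim0 {χ | χ.Realize (Sum.elim Fin.elim0 c)}
    (ψ.relabel Sum.inr) (isQF_relabel hψ _) fun s hs => by
      let r : Fin 0 ⊕ Fin n → Empty ⊕ Fin n := Sum.elim Fin.elim0 Sum.inr
      have hr {M : Type} (y : Fin n → M) : Sum.elim default y ∘ r = Sum.elim Fin.elim0 y := by
        ext (q | q)
        · exact q.elim0
        · rfl
      obtain ⟨θ, hθ, hiff⟩ := hqe.exists_isExistential (L' := L') (α := Empty)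
        (s.image (Formula.relabel r)) (isQF_relabel hψ Sum.inr)
      have hVθ : V ⊨ θ := by
        refine (hiff V (models_left hTT₀ V.models) default).2 ⟨i ∘ c, fun χ hχ => ?_,
          Formula.realize_relabel.2 ?_⟩
        · obtain ⟨χ, hχs, rfl⟩ := Finset.mem_image.1 hχ
          rw [Formula.realize_relabel, hr]
          have := (sameType_elementary i' (Sum.elim Fin.elim0 c) χ).1 (hs hχs)
          convert this using 1
          ext (q | q)
          · exact q.elim0
          · exact (congrFun hi' _).symm
        · exact (realize_qf_embedding i hψ c).2 hc
      have hNθ := (@hsame V _ _ N _ α.str hV (hα.2.2.isECModel hα.1) θ hθ).1 hVθ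
      let _ := α.str
      obtain ⟨y, hy, hyψ⟩ := (hiff N hNT default).1 hNθ
      refine ⟨y, ?_, fun χ hχ => ?_⟩
      · rw [Formula.realize_relabel] at hyψ ⊢
        exact hyψ
      · have := hy _ (Finset.mem_image_of_mem _ hχ)
        rwa [Formula.realize_relabel, hr] at this
  have hxψ : α.Sat ψ x := (α.sat_relabel ψ Sum.inr _).1 hx
  have hst : SameType L x c := by
    intro φ
    have (φ : L.Formula (Fin n)) (h : φ.Realize c) : φ.Realize x := by
      have := hxp (φ.relabel Sum.inr) (Formula.realize_relabel.2 h)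
      rwa [Formula.realize_relabel] at this
    refine ⟨fun h => by_contra fun hn => ?_, this φ⟩
    exact Formula.realize_not.1 (this (∼φ) (Formula.realize_not.2 hn)) h
  obtain ⟨g, rfl⟩ := hst.exists_equiv hsat
  exact ⟨g, (sat_conjExp g α ψ x).2 hxψ⟩

theorem isOpen_realizeAt {n : ℕ} (π : EQF L L' n) (b : Fin n → N) :
    IsOpen {σ : Expansions L L' N | π.RealizeAt σ b} := by
  have : {σ : Expansions L L' N | π.RealizeAt σ b} =
      ⋃ (y : Fin π.m → N) (_ : ∀ χ ∈ π.p, χ.Realize (Sum.elim b y)),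
        {σ : Expansions L L' N | σ.Sat π.φ (Sum.elim b y)} := by
    ext σ
    simp only [Set.mem_iUnion, exists_prop]
    exact Iff.rfl
  rw [this]
  exact isOpen_iUnion fun y => isOpen_iUnion fun _ => isOpen_sat π.qf _

theorem isOpen_isolated (T₀ : (L.sum L').Theory) {n : ℕ} (b : Fin n → N) :
    IsOpen {σ : Expansions L L' N | ∃ Γ : Set (EQF L L' n), Γ.Finite ∧ IsolatedBy T₀ b Γ ∧
      ∀ π ∈ Γ, π.RealizeAt σ b} := by
  have : {σ : Expansions L L' N | ∃ Γ : Set (EQF L L' n), Γ.Finite ∧ IsolatedBy T₀ b Γ ∧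
      ∀ π ∈ Γ, π.RealizeAt σ b} = ⋃ (Γ : Set (EQF L L' n)) (_ : Γ.Finite)
        (_ : IsolatedBy T₀ b Γ), ⋂ π ∈ Γ, {σ : Expansions L L' N | π.RealizeAt σ b} := by
    ext σ
    simp only [Set.mem_iUnion, Set.mem_iInter, exists_prop]
    exact Iff.rfl
  rw [this]
  exact isOpen_iUnion fun Γ => isOpen_iUnion fun hf => isOpen_iUnion fun _ =>
    hf.isOpen_biInter fun π _ => isOpen_realizeAt π b

theorem eventually_residual_isEAtomic [Countable N] [Nonempty N] [Finite (Σ i, L'.Functions i)]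
    [Finite (Σ i, L'.Relations i)] (hNT : N ⊨ T) (hqe : HasQE L T)
    (hsat : IsSaturated L N) (hTT₀ : (LHom.sumInl : L →ᴸ L.sum L').onTheory T ⊆ T₀)
    (huniv : UniversalTheoryModulo L L' T T₀) (hsame : SameExistentialTheory L L' T₀)
    {α : Expansions L L' N} (hα : IsEAtomic L L' N T₀ α) :
    ∀ᶠ σ : ↥(ExpSet L L' N T₀) in residual _, IsEAtomic L L' N T₀ σ := by
  simp only [isEAtomic_iff hNT hqe]
  refine (eventually_residual_mem_YSet N hNT hqe hsat hTT₀ huniv).and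
    (eventually_countable_forall.2 fun n => eventually_countable_forall.2 fun b =>
      residual_of_dense_open ((isOpen_isolated T₀ b).preimage continuous_subtype_val) ?_)
  refine dense_iff_inter_open.2 fun O hO ⟨σ, hσ⟩ => ?_
  obtain ⟨V, hV, rfl⟩ := isOpen_induced_iff.1 hO
  obtain ⟨m, ψ, c, hψ, hσψ, hψV⟩ := exists_sat_subset_of_isOpen hV hσ
  obtain ⟨g, hg⟩ := exists_sat_conjExp hNT hqe hsat hTT₀ huniv hsame hα.1 σ.2 hψ hσψ
  exact ⟨⟨conjExp g α, modelsTh_conjExp g α hα.1.1⟩, hψV _ hg,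
    ((isEAtomic_iff hNT hqe).1 (isEAtomic_conjExp hNT hqe g hα)).2 n b⟩

end Density

section Empty

variable {T : L.Theory} {T₀ : (L.sum L').Theory}

/-- If `N` is empty and some expansion is existentially closed, then it is the only expansion
satisfying `T₀`. -/
theorem eq_of_isEmpty [IsEmpty N] (hqe : HasQE L T)
    (hTT₀ : (LHom.sumInl : L →ᴸ L.sum L').onTheory T ⊆ T₀)
    (huniv : UniversalTheoryModulo L L' T T₀) (hsame : SameExistentialTheory L L' T₀)
    {α σ : Expansions L L' N} (hα : α ∈ YSet L L' N T₀) (hσ : σ.ModelsTh T₀) : σ = α := by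
  have hα' := hα.2.2.isECModel hα.1
  have hσ' : @IsECModel L L' T₀ N _ σ.str := by
    refine Expansions.IsEC.isECModel ?_ hσ
    rintro k n φ c hφ ⟨U, iU, iU', j, hU, x, hx⟩
    rcases isEmpty_or_nonempty U with hUe | hUn
    · have hxj : x = j ∘ fun i => isEmptyElim (x i) := funext fun i => isEmptyElim (x i)
      refine ⟨fun i => isEmptyElim (x i), ?_⟩
      rw [hxj, ← Sum.comp_elim] at hx
      exact (@realize_qf_embedding (L.sum L') N U _ σ.str0 _ j φ hφ _).1 hx
    · exfalso
      obtain ⟨V, i, hV, -⟩ := exists_extension_ec_saturated hqe hTT₀ huniv ⟨U, hU⟩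
      have := (@hsame V _ _ N _ α.str hV hα' ((⊤ : (L.sum L').Formula (Empty ⊕ Fin 1)).iExs (Fin 1))
        (isExistential_iExs .top)).1
        (Formula.realize_iExs.2 ⟨fun _ => Classical.arbitrary V, Formula.realize_top.2 trivial⟩)
      let _ := α.str
      obtain ⟨y, -⟩ := Formula.realize_iExs.1 this
      exact isEmptyElim (y 0)
  refine @Structure.ext _ _ σ.str α.str (funext fun n => funext fun f => funext fun x =>
    isEmptyElim (σ.str.funMap f x)) (funext fun n => funext fun R => funext fun x => ?_)
  obtain rfl | hn := Nat.eq_zero_or_pos n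
  · let φ : (L.sum L').Sentence := Relations.formula (Sum.inr R) Fin.elim0
    have := @hsame N _ σ.str N _ α.str hσ' hα' φ
      (BoundedFormula.IsAtomic.rel _ _).isExistential
    have key (τ : Expansions L L' N) :
        τ.Sat φ default ↔ τ.str.RelMap R x := by
      let _ := τ.str0
      refine Formula.realize_rel.trans ?_
      exact iff_of_eq (congrArg (τ.str.RelMap R) (Subsingleton.elim _ _))
    exact propext ((key σ).symm.trans (this.trans (key α)))
  · exact isEmptyElim (x ⟨0, hn⟩)

end Empty

/-- Suppose all e.c. models of `T₀` have the same existential theory.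
If an e-atomic expansion of `N` exists, then the set of e-atomic expansions is comeagre
in `Exp(N, T₀)`. -/
theorem statement10
    (T : L.Theory) (T₀ : (L.sum L').Theory)
    [Countable N] (hNT : N ⊨ T) (hTc : T.IsComplete) (hqe : HasQE L T)
    (hsmall : IsSmall L T) (hsat : IsSaturated L N)
    [Finite (Σ i, L'.Functions i)] [Finite (Σ i, L'.Relations i)]
    (hTT₀ : (LHom.sumInl : L →ᴸ L.sum L').onTheory T ⊆ T₀)
    (huniv : UniversalTheoryModulo L L' T T₀)
    (hsame : SameExistentialTheory L L' T₀)
    (hex : ∃ α : Expansions L L' N, IsEAtomic L L' N T₀ α) :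
    {σ : ↥(ExpSet L L' N T₀) | IsEAtomic L L' N T₀ ↑σ} ∈
      residual ↥(ExpSet L L' N T₀) := by
  obtain ⟨α, hα⟩ := hex
  rcases isEmpty_or_nonempty N with hN | hN
  · refine Filter.mem_of_superset Filter.univ_mem fun σ _ => ?_
    rw [Set.mem_ofPred_eq, eq_of_isEmpty hqe hTT₀ huniv hsame hα.1 σ.2]
    exact hα
  · exact eventually_residual_isEAtomic hNT hqe hsat hTT₀ huniv hsame hα

end GenExp
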